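/- Fix a real p > 2. There exists β₀ = β₀(p) such that for every β ≥ β₀ there is a constant c = c(β,p) > 0 with the following property: for every integer h ≥ 1 and every z ∈ ℤ² with z ≠ 0 there exists L₀ = L₀(β,h,z) such that for all integers L ≥ L₀, π^{(p)}_{B_L}(η_z = h and η_0 = h) ≤ e^{−c·β·h} · π^{(p)}_{B_L}(η_0 = h). -/

import Mathlib

open Filter Topology Classical

noncomputable section

abbrev Site : Type := ℤ × ℤ

/-- Nearest-neighbor adjacency in `ℤ²`. -/
def adjP (x y : Site) : Prop := |x.1 - y.1| + |x.2 - y.2| = 1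

/-- The `p`-SOS Hamiltonian `∑_{x∼y} |η_x − η_y|^p` (each ordered pair counted once,
whence the factor 1/2). -/
def pH (p : ℝ) (η : Site → ℤ) : ℝ :=
  (1 / 2) * ∑' pr : Site × Site,
    if adjP pr.1 pr.2 then ((|η pr.1 - η pr.2| : ℤ) : ℝ) ^ p else 0

/-- Unnormalized weight of the event `A` for the `p`-SOS model on `Λ` with zero
boundary conditions. -/
def pW (p β : ℝ) (Λ : Finset Site) (A : (Site → ℤ) → Prop) : ℝ :=
  ∑' η : Site → ℤ, if (∀ x ∉ Λ, η x = 0) ∧ A η then Real.exp (-β * pH p η) else 0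

/-- `π^{(p)}_Λ(A)`: probability of the event `A` under the `p`-SOS measure on `Λ`. -/
def pProb (p β : ℝ) (Λ : Finset Site) (A : (Site → ℤ) → Prop) : ℝ :=
  pW p β Λ A / pW p β Λ (fun _ => True)

/-- The lattice ball `B_r = {x ∈ ℤ² : |x| ≤ r}`. -/
def ball (r : ℝ) : Finset Site :=
  ((Finset.Icc (-⌈r⌉) ⌈r⌉) ×ˢ (Finset.Icc (-⌈r⌉) ⌈r⌉)).filter
    fun x => ((x.1 : ℝ) ^ 2 + (x.2 : ℝ) ^ 2 ≤ r ^ 2)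

section

def V (p : ℝ) (n : ℤ) : ℝ := ((|n| : ℤ) : ℝ) ^ p
def dV (p : ℝ) (n : ℤ) : ℝ := V p n - V p (n - 1)

lemma V_neg (p : ℝ) (n : ℤ) : V p (-n) = V p n := by simp [V]
lemma V_nonneg (p : ℝ) (n : ℤ) : 0 ≤ V p n := by unfold V; positivity
lemma V_zero {p : ℝ} (hp : 2 < p) : V p 0 = 0 := by
  unfold V; simp; exact Real.zero_rpow (by linarith)
lemma V_one (p : ℝ) : V p 1 = 1 := by simp [V]

lemma V_mid {p : ℝ} (hp : 2 < p) (n : ℤ) : 2 * V p n ≤ V p (n + 1) + V p (n - 1) := by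
  unfold V
  have h1 : 2 * |n| ≤ |n+1| + |n-1| := by
    have := abs_add_le (n+1) (n-1)
    have e : (n+1) + (n-1) = 2*n := by ring
    rw [e, abs_mul] at this; simpa using this
  have h1' : (2:ℝ) * ((|n| : ℤ):ℝ) ≤ ((|n+1| : ℤ):ℝ) + ((|n-1| : ℤ):ℝ) := by exact_mod_cast h1
  have ha : (0:ℝ) ≤ ((|n+1| : ℤ):ℝ) := by exact_mod_cast abs_nonneg _
  have hb : (0:ℝ) ≤ ((|n-1| : ℤ):ℝ) := by exact_mod_cast abs_nonneg _
  have hc : (0:ℝ) ≤ ((|n| : ℤ):ℝ) := by exact_mod_cast abs_nonneg _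
  have hcx := convexOn_rpow (p := p) (by linarith)
  have := hcx.2 (Set.mem_Ici.2 ha) (Set.mem_Ici.2 hb) (show (0:ℝ) ≤ 1/2 by norm_num)
    (show (0:ℝ) ≤ 1/2 by norm_num) (by norm_num)
  simp only [smul_eq_mul] at this
  have h2 : ((|n| : ℤ):ℝ)^p ≤ (1/2 * ((|n+1| : ℤ):ℝ) + 1/2 * ((|n-1| : ℤ):ℝ))^p := by
    apply Real.rpow_le_rpow hc _ (by linarith)
    linarith
  linarith

lemma dV_mono {p : ℝ} (hp : 2 < p) : Monotone (dV p) := by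
  apply monotone_int_of_le_succ
  intro n
  have := V_mid hp n
  unfold dV
  have e : n + 1 - 1 = n := by ring
  rw [e]; linarith

lemma V_shift {p : ℝ} (hp : 2 < p) (m w : ℤ) (h : m ≤ w) (d : ℕ) :
    V p (m + d) - V p m ≤ V p (w + d) - V p w := by
  induction d with
  | zero => simp
  | succ d ih =>
    have := dV_mono hp (show m + d + 1 ≤ w + d + 1 by linarith)
    unfold dV at this
    simp only [add_sub_cancel_right] at this
    push_cast
    rw [← add_assoc, ← add_assoc]
    linarith

lemma V_four {p : ℝ} (hp : 2 < p) {m u v M : ℤ} (h1 : m ≤ u) (h2 : m ≤ v) (h : u + v = m + M) :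
    V p u + V p v ≤ V p m + V p M := by
  obtain ⟨d, hd⟩ := Int.eq_ofNat_of_zero_le (sub_nonneg.2 h1)
  have e1 : u = m + d := by omega
  have e2 : M = v + d := by omega
  have := V_shift hp m v h2 d
  rw [e1, e2]; linarith

lemma V_minmax {p : ℝ} (hp : 2 < p) (a b a' b' : ℤ) :
    V p (min a a' - min b b') + V p (max a a' - max b b') ≤ V p (a - b) + V p (a' - b') := by
  rcases le_total a a' with h | h <;> rcases le_total b b' with k | k <;> simp only [min_eq_left, min_eq_right, max_eq_left, max_eq_right, h, k]
  · exact le_rfl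
  · have := V_four hp (m := a - b) (M := a' - b') (u := a - b') (v := a' - b) (by omega) (by omega) (by ring)
    linarith
  · have := V_four hp (m := a' - b') (M := a - b) (u := a' - b) (v := a - b') (by omega) (by omega) (by ring)
    linarith
  · linarith

lemma V_minmax' {p : ℝ} (hp : 2 < p) (a b a' b' : ℤ) (k : b ≤ b') :
    V p (min a a' - b) + V p (max a a' - b') ≤ V p (a - b) + V p (a' - b') := by
  have := V_minmax hp a b a' b'
  rwa [min_eq_left k, max_eq_right k] at this

lemma dV_zero {p : ℝ} (hp : 2 < p) : dV p 0 = -1 := by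
  unfold dV; rw [V_zero hp, show (0:ℤ) - 1 = -1 by ring, V_neg, V_one]; ring
lemma dV_one {p : ℝ} (hp : 2 < p) : dV p 1 = 1 := by
  unfold dV; simp [V_zero hp, V_one]
lemma dV_neg (p : ℝ) (n : ℤ) : dV p (-n) = - dV p (n+1) := by
  unfold dV
  rw [V_neg, show -n - 1 = -(n+1) by ring, V_neg, show n + 1 - 1 = n by ring]; ring

lemma V_nat (p : ℝ) (n : ℕ) : V p n = (n:ℝ)^p := by simp [V]

lemma dV_ge {p : ℝ} (hp : 2 < p) (t : ℕ) (ht : 1 ≤ t) : (t:ℝ)^(p-1) ≤ dV p t := by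
  obtain ⟨s, rfl⟩ : ∃ s, t = s + 1 := ⟨t-1, by omega⟩
  unfold dV
  rw [show ((s+1:ℕ):ℤ) - 1 = (s:ℕ) by push_cast; ring, V_nat, V_nat]
  have e1 : ((s+1:ℕ):ℝ)^p = ((s+1:ℕ):ℝ)^(p-1) * ((s+1:ℕ):ℝ) := by
    rw [← Real.rpow_add_one (by positivity)]; ring_nf
  have e2 : (s:ℝ)^p ≤ ((s+1:ℕ):ℝ)^(p-1) * s := by
    rcases Nat.eq_zero_or_pos s with h | h
    · subst h; simp; rw [Real.zero_rpow (by linarith)]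
    · have : (s:ℝ)^p = (s:ℝ)^(p-1) * (s:ℝ) := by
        rw [← Real.rpow_add_one (by positivity)]; ring_nf
      rw [this]
      gcongr
      · linarith
      · simp
  rw [e1]; push_cast at *; nlinarith

lemma dV_ge_one {p : ℝ} (hp : 2 < p) (t : ℤ) (ht : 1 ≤ t) : 1 ≤ dV p t := by
  rw [← dV_one hp]; exact dV_mono hp ht

def Cp (p : ℝ) : ℝ := p * 2 ^ (p - 1)

lemma Cp_ge {p : ℝ} (hp : 2 < p) : 1 ≤ Cp p := by
  unfold Cp
  have : (1:ℝ) ≤ 2^(p-1) := Real.one_le_rpow (by norm_num) (by linarith)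
  nlinarith

lemma dV_succ_le {p : ℝ} (hp : 2 < p) (t : ℤ) (ht : 0 ≤ t) : dV p (t+1) ≤ Cp p * (dV p t + 2) := by
  rcases eq_or_lt_of_le ht with h | h
  · subst h
    rw [zero_add, dV_one hp, dV_zero hp]; have := Cp_ge hp; linarith
  · obtain ⟨n, rfl⟩ := Int.eq_ofNat_of_zero_le ht
    have hn : 1 ≤ n := by omega
    have h1 := dV_ge hp n hn
    have h2 : dV p ((n:ℤ)+1) ≤ Cp p * (n:ℝ)^(p-1) := by
      unfold dV
      rw [add_sub_cancel_right, V_nat, show (n:ℤ)+1 = ((n+1:ℕ):ℤ) by push_cast; ring, V_nat]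
      push_cast
      have hn0 : (0:ℝ) < n := by exact_mod_cast hn
      have hb := one_add_mul_self_le_rpow_one_add (s := -(1/((n:ℝ)+1))) (p := p)
        (by
          have : 1/((n:ℝ)+1) ≤ 1 := by rw [div_le_one (by positivity)]; linarith
          linarith) (by linarith)
      have e : 1 + -(1/((n:ℝ)+1)) = n / (n+1) := by field_simp; ring
      rw [e, Real.div_rpow hn0.le (by positivity)] at hb
      have hpos : 0 < ((n:ℝ)+1)^p := by positivity
      rw [le_div_iff₀ hpos] at hb
      have e1 : ((n:ℝ)+1)^p = ((n:ℝ)+1)^(p-1) * ((n:ℝ)+1) := by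
        rw [← Real.rpow_add_one (by positivity)]; ring_nf
      have e3 : p * (1/((n:ℝ)+1)) * ((n:ℝ)+1)^p = p * ((n:ℝ)+1)^(p-1) := by
        rw [e1]; field_simp
      have e4 : ((n:ℝ)+1)^(p-1) ≤ 2^(p-1) * (n:ℝ)^(p-1) := by
        rw [← Real.mul_rpow (by norm_num) hn0.le]
        apply Real.rpow_le_rpow (by positivity) _ (by linarith)
        have : (1:ℝ) ≤ n := by exact_mod_cast hn
        linarith
      unfold Cp
      have e5 : p * ((n:ℝ)+1)^(p-1) ≤ p * (2^(p-1) * (n:ℝ)^(p-1)) := by gcongr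
      nlinarith
    have := Cp_ge hp
    calc _ ≤ _ := h2
      _ ≤ Cp p * (dV p n + 2) := by gcongr; linarith

end

section

abbrev Edge : Type := Site × Bool
def tip (e : Edge) : Site := if e.2 then (e.1.1 + 1, e.1.2) else (e.1.1, e.1.2 + 1)
def Ed (D : Finset Site) : Finset Edge :=
  (D ∪ D.image (fun x => (x.1 - 1, x.2)) ∪ D.image (fun x => (x.1, x.2 - 1))) ×ˢ Finset.univ
def Supp (D : Finset Site) (η : Site → ℤ) : Prop := ∀ x ∉ D, η x = 0

lemma mem_Ed {D : Finset Site} {e : Edge} (h : e.1 ∈ D ∨ tip e ∈ D) : e ∈ Ed D := by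
  unfold Ed
  obtain ⟨⟨a, b⟩, c⟩ := e
  simp only [Finset.mem_product, Finset.mem_union, Finset.mem_image, Finset.mem_univ, and_true]
  rcases h with h | h
  · exact Or.inl (Or.inl h)
  · cases c
    · exact Or.inr ⟨_, h, by simp [tip]⟩
    · exact Or.inl (Or.inr ⟨_, h, by simp [tip]⟩)

def prmap (q : Edge × Bool) : Site × Site := if q.2 then (q.1.1, tip q.1) else (tip q.1, q.1.1)

lemma prmap_inj : Function.Injective prmap := by
  rintro ⟨⟨⟨a, b⟩, c⟩, d⟩ ⟨⟨⟨a', b'⟩, c'⟩, d'⟩ h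
  cases c <;> cases d <;> cases c' <;> cases d' <;> simp [prmap, tip] at h ⊢ <;> omega

lemma prmap_range {x y : Site} (h : adjP x y) : (x, y) ∈ Set.range prmap := by
  obtain ⟨a, b⟩ := x
  obtain ⟨c, d⟩ := y
  unfold adjP at h
  simp only at h
  have : (c = a + 1 ∧ d = b) ∨ (c = a ∧ d = b + 1) ∨ (a = c + 1 ∧ b = d) ∨ (a = c ∧ b = d + 1) := by
    rcases abs_cases (a - c) with ⟨h1, h2⟩ | ⟨h1, h2⟩ <;> rcases abs_cases (b - d) with ⟨h3, h4⟩ | ⟨h3, h4⟩ <;> rw [h1, h3] at h <;> omega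
  rcases this with ⟨rfl, rfl⟩ | ⟨rfl, rfl⟩ | ⟨rfl, rfl⟩ | ⟨rfl, rfl⟩
  · exact ⟨(((_, _), true), true), rfl⟩
  · exact ⟨(((_, _), false), true), rfl⟩
  · exact ⟨(((_, _), true), false), rfl⟩
  · exact ⟨(((_, _), false), false), rfl⟩

lemma adj_tip (e : Edge) : adjP e.1 (tip e) ∧ adjP (tip e) e.1 := by
  obtain ⟨⟨a, b⟩, c⟩ := e
  cases c <;> simp [adjP, tip]

lemma pH_sum {p : ℝ} (hp : 2 < p) {D : Finset Site} {η : Site → ℤ} (hs : Supp D η) (E : Finset Edge)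
    (hE : ∀ e, e.1 ∈ D ∨ tip e ∈ D → e ∈ E) :
    pH p η = ∑ e ∈ E, V p (η e.1 - η (tip e)) := by
  unfold pH
  rw [← prmap_inj.tsum_eq]
  · rw [tsum_eq_sum (s := E ×ˢ Finset.univ)]
    · rw [Finset.sum_product, Finset.mul_sum]
      apply Finset.sum_congr rfl
      intro e _
      simp only [Fintype.sum_bool, prmap, if_true, (adj_tip e).1, (adj_tip e).2, Bool.false_eq_true, if_false]
      have : V p (η (tip e) - η e.1) = V p (η e.1 - η (tip e)) := by
        rw [← V_neg]; congr 1; ring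
      unfold V at this ⊢
      rw [this]; ring
    · rintro ⟨e, b⟩ h
      have he : e ∉ E := by simpa using h
      have h1 : e.1 ∉ D := fun k => he (hE e (Or.inl k))
      have h2 : tip e ∉ D := fun k => he (hE e (Or.inr k))
      have hz : (0:ℝ)^p = 0 := Real.zero_rpow (by linarith)
      cases b <;> simp [prmap, hs _ h1, hs _ h2, hz]
  · rintro ⟨x, y⟩ h
    apply prmap_range
    by_contra hc
    simp [hc] at h

def bd (C : Finset Site) : Finset Edge := (Ed C).filter fun e => ¬ (e.1 ∈ C ↔ tip e ∈ C)
def inn (C : Finset Site) (e : Edge) : Site := if e.1 ∈ C then e.1 else tip e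
def out (C : Finset Site) (e : Edge) : Site := if e.1 ∈ C then tip e else e.1
def low (C : Finset Site) (η : Site → ℤ) : Site → ℤ := fun x => η x - if x ∈ C then 1 else 0
def Flx (p : ℝ) (C : Finset Site) (η : Site → ℤ) : ℝ := ∑ e ∈ bd C, dV p (η (inn C e) - η (out C e))

lemma mem_bd {C : Finset Site} {e : Edge} : e ∈ bd C ↔ ¬ (e.1 ∈ C ↔ tip e ∈ C) := by
  unfold bd
  rw [Finset.mem_filter, and_iff_right_iff_imp]
  intro h
  apply mem_Ed
  tauto

lemma inn_mem {C : Finset Site} {e : Edge} (h : e ∈ bd C) : inn C e ∈ C := by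
  rw [mem_bd] at h; unfold inn; split_ifs <;> tauto
lemma out_mem {C : Finset Site} {e : Edge} (h : e ∈ bd C) : out C e ∉ C := by
  rw [mem_bd] at h; unfold out; split_ifs <;> tauto

lemma low_inj (C : Finset Site) : Function.Injective (low C) := by
  intro a b h
  funext x
  have := congrFun h x
  unfold low at this
  omega

lemma supp_low {C D : Finset Site} (h : C ⊆ D) {η : Site → ℤ} (hs : Supp D η) : Supp D (low C η) := by
  intro x hx
  have : x ∉ C := fun k => hx (h k)
  simp [low, this, hs x hx]

lemma pH_low {p : ℝ} (hp : 2 < p) {C D : Finset Site} (h : C ⊆ D) {η : Site → ℤ} (hs : Supp D η) :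
    pH p η = pH p (low C η) + Flx p C η := by
  rw [pH_sum hp hs (Ed D) (fun e => mem_Ed), pH_sum hp (supp_low h hs) (Ed D) (fun e => mem_Ed)]
  unfold Flx
  have hsub : bd C ⊆ Ed D := by
    intro e he
    apply mem_Ed
    rw [mem_bd] at he
    by_cases k : e.1 ∈ C
    · exact Or.inl (h k)
    · exact Or.inr (h (by tauto))
  have e1 : bd C = (Ed D).filter (fun e => e ∈ bd C) := by
    ext e; simp only [Finset.mem_filter]; exact ⟨fun k => ⟨hsub k, k⟩, fun k => k.2⟩
  rw [e1, Finset.sum_filter, ← Finset.sum_add_distrib]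
  apply Finset.sum_congr rfl
  intro e _
  have hm := mem_bd (C := C) (e := e)
  by_cases k1 : e.1 ∈ C <;> by_cases k2 : tip e ∈ C
  · have : e ∉ bd C := by tauto
    simp [this, low, k1, k2]
  · have : e ∈ bd C := by tauto
    simp [this, low, k1, k2, inn, out, dV]
    rw [show η e.1 - 1 - η (tip e) = η e.1 - η (tip e) - 1 by ring]
    ring
  · have : e ∈ bd C := by tauto
    simp [this, low, k1, k2, inn, out, dV]
    rw [← V_neg p (η e.1 - η (tip e)), ← V_neg p (η e.1 - (η (tip e) - 1))]
    rw [show -(η e.1 - η (tip e)) = η (tip e) - η e.1 by ring, show -(η e.1 - (η (tip e) - 1)) = η (tip e) - η e.1 - 1 by ring]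
    ring
  · have : e ∉ bd C := by tauto
    simp [this, low, k1, k2]

open ENNReal in
def wt (p β : ℝ) (η : Site → ℤ) : ℝ≥0∞ := ENNReal.ofReal (Real.exp (-β * pH p η))

open ENNReal in
def W (p β : ℝ) (D : Finset Site) (A : (Site → ℤ) → Prop) : ℝ≥0∞ :=
  ∑' η : Site → ℤ, if Supp D η ∧ A η then wt p β η else 0

lemma W_mono {p β : ℝ} {D : Finset Site} {A B : (Site → ℤ) → Prop} (h : ∀ η, Supp D η → A η → B η) :
    W p β D A ≤ W p β D B := by
  apply ENNReal.tsum_le_tsum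
  intro η
  by_cases k : Supp D η ∧ A η
  · rw [if_pos k, if_pos ⟨k.1, h η k.1 k.2⟩]
  · rw [if_neg k]; exact zero_le

lemma W_congr {p β : ℝ} {D : Finset Site} {A B : (Site → ℤ) → Prop} (h : ∀ η, Supp D η → (A η ↔ B η)) :
    W p β D A = W p β D B :=
  le_antisymm (W_mono fun η k => (h η k).1) (W_mono fun η k => (h η k).2)

lemma W_split {p β : ℝ} {D : Finset Site} (A B : (Site → ℤ) → Prop) :
    W p β D A = W p β D (fun η => A η ∧ B η) + W p β D (fun η => A η ∧ ¬ B η) := by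
  unfold W
  rw [← ENNReal.tsum_add]
  congr 1; funext η
  by_cases k : Supp D η <;> by_cases k1 : A η <;> by_cases k2 : B η <;> simp [k, k1, k2]

lemma W_le_tsum {p β : ℝ} {D : Finset Site} {ι : Type*} (A : (Site → ℤ) → Prop) (B : ι → (Site → ℤ) → Prop)
    (h : ∀ η, Supp D η → A η → ∃ i, B i η) :
    W p β D A ≤ ∑' i, W p β D (fun η => A η ∧ B i η) := by
  unfold W
  rw [ENNReal.tsum_comm]
  apply ENNReal.tsum_le_tsum
  intro η
  by_cases k : Supp D η ∧ A η
  · obtain ⟨i, hi⟩ := h η k.1 k.2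
    rw [if_pos k]
    refine le_trans ?_ (ENNReal.le_tsum i)
    rw [if_pos ⟨k.1, k.2, hi⟩]
  · rw [if_neg k]; exact zero_le

lemma W_le_add {p β : ℝ} {D : Finset Site} (A B C : (Site → ℤ) → Prop)
    (h : ∀ η, Supp D η → A η → B η ∨ C η) :
    W p β D A ≤ W p β D B + W p β D C := by
  rw [W_split A B]
  refine add_le_add (W_mono fun η _ k => k.2) (W_mono fun η hs k => ?_)
  have := h η hs k.1
  tauto

lemma wt_le {p β δ : ℝ} (hβ : 0 ≤ β) {η η' : Site → ℤ} (h : pH p η' + δ ≤ pH p η) :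
    wt p β η ≤ ENNReal.ofReal (Real.exp (-β * δ)) * wt p β η' := by
  unfold wt
  rw [← ENNReal.ofReal_mul (Real.exp_nonneg _), ← Real.exp_add]
  apply ENNReal.ofReal_le_ofReal
  apply Real.exp_le_exp.2
  nlinarith

lemma W_inj {p β δ : ℝ} (hβ : 0 ≤ β) {D D' : Finset Site} {A B : (Site → ℤ) → Prop}
    (T : (Site → ℤ) → (Site → ℤ)) (hT : Function.Injective T)
    (h : ∀ η, Supp D η → A η → Supp D' (T η) ∧ B (T η) ∧ pH p (T η) + δ ≤ pH p η) :
    W p β D A ≤ ENNReal.ofReal (Real.exp (-β * δ)) * W p β D' B := by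
  unfold W
  rw [← ENNReal.tsum_mul_left]
  refine le_trans (ENNReal.tsum_le_tsum (g := fun η => ENNReal.ofReal (Real.exp (-β * δ)) * (if Supp D' (T η) ∧ B (T η) then wt p β (T η) else 0)) ?_)
    (ENNReal.tsum_comp_le_tsum_of_injective hT _)
  intro η
  by_cases k : Supp D η ∧ A η
  · obtain ⟨h1, h2, h3⟩ := h η k.1 k.2
    rw [if_pos k, if_pos ⟨h1, h2⟩]
    exact wt_le hβ h3
  · rw [if_neg k]; exact zero_le

lemma W_peierls {p β : ℝ} (hβ : 0 ≤ β) {D D' : Finset Site} {A B : (Site → ℤ) → Prop} {ι : Type*}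
    (P : ι → Prop) (w : ι → ℝ)
    (T : ι → (Site → ℤ) → (Site → ℤ)) (hT : ∀ i, Function.Injective (T i))
    (h : ∀ η, Supp D η → A η → ∃ i, P i ∧ Supp D' (T i η) ∧ B (T i η) ∧ pH p (T i η) + w i ≤ pH p η) :
    W p β D A ≤ (∑' i, if P i then ENNReal.ofReal (Real.exp (-β * w i)) else 0) * W p β D' B := by
  refine le_trans (W_le_tsum A (fun i η => P i ∧ Supp D' (T i η) ∧ B (T i η) ∧ pH p (T i η) + w i ≤ pH p η) h) ?_
  rw [← ENNReal.tsum_mul_right]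
  apply ENNReal.tsum_le_tsum
  intro i
  by_cases hi : P i
  · rw [if_pos hi]
    apply W_inj hβ (T i) (hT i)
    rintro η _ ⟨_, _, h1, h2, h3⟩
    exact ⟨h1, h2, h3⟩
  · rw [if_neg hi, zero_mul]
    have : W p β D (fun η => A η ∧ P i ∧ Supp D' (T i η) ∧ B (T i η) ∧ pH p (T i η) + w i ≤ pH p η) = 0 := by
      unfold W; simp [hi]
    rw [this]

lemma W_zero_pos {p β : ℝ} (D : Finset Site) {A : (Site → ℤ) → Prop} (h : A (fun _ => 0)) : W p β D A ≠ 0 := by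
  unfold W
  intro k
  rw [ENNReal.tsum_eq_zero] at k
  have := k (fun _ => 0)
  rw [if_pos ⟨fun _ _ => rfl, h⟩] at this
  unfold wt at this
  rw [ENNReal.ofReal_eq_zero] at this
  linarith [Real.exp_pos (-β * pH p fun _ => 0)]

end

section

def plaq (q : Site) : Finset Edge :=
  {(q, true), (q, false), ((q.1, q.2 + 1), true), ((q.1 + 1, q.2), false)}
def Close (e f : Edge) : Prop := ∃ q, e ∈ plaq q ∧ f ∈ plaq q
def EConn (S : Finset Edge) : Edge → Edge → Prop :=
  Relation.ReflTransGen (fun a b => Close a b ∧ a ∈ S ∧ b ∈ S)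
def Ctr (x : Site) (C : Finset Site) : Prop := x ∈ C ∧ ∀ e ∈ bd C, ∀ f ∈ bd C, EConn (bd C) e f

lemma Close.symm {e f : Edge} (h : Close e f) : Close f e := by
  obtain ⟨q, a, b⟩ := h; exact ⟨q, b, a⟩

lemma EConn.symm {S : Finset Edge} {e f : Edge} (h : EConn S e f) : EConn S f e := by
  induction h with
  | refl => exact Relation.ReflTransGen.refl
  | tail _ h ih => exact Relation.ReflTransGen.head ⟨h.1.symm, h.2.2, h.2.1⟩ ih

section ctr
variable (A : Finset Site)

def ind (y : Site) : ℤ := if y ∈ A then 1 else 0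
def dA (e : Edge) : ℤ := ind A e.1 - ind A (tip e)

lemma dA_ne {e : Edge} : dA A e ≠ 0 ↔ e ∈ bd A := by
  rw [mem_bd]; unfold dA ind
  by_cases h : e.1 ∈ A <;> by_cases k : tip e ∈ A <;> simp [h, k]

variable (S : Finset Edge)
def psi (y : Site) : ℤ :=
  ∑ e ∈ S.filter (fun e => e.2 = true ∧ e.1.2 = y.2 ∧ y.1 ≤ e.1.1), dA A e
def dS (e : Edge) : ℤ := if e ∈ S then dA A e else 0

lemma psi_h (y : Site) : psi A S y - psi A S (y.1 + 1, y.2) = dS A S (y, true) := by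
  unfold psi dS
  by_cases h : (y, true) ∈ S
  · have : S.filter (fun e => e.2 = true ∧ e.1.2 = y.2 ∧ y.1 ≤ e.1.1) =
      insert (y, true) (S.filter (fun e => e.2 = true ∧ e.1.2 = y.2 ∧ y.1 + 1 ≤ e.1.1)) := by
      ext ⟨⟨a, b⟩, c⟩
      obtain ⟨y1, y2⟩ := y
      simp only [Finset.mem_filter, Finset.mem_insert, Prod.mk.injEq]
      constructor
      · rintro ⟨h1, h2, h3, h4⟩
        by_cases k : a = y1
        · left; exact ⟨⟨k, h3⟩, h2⟩
        · right; exact ⟨h1, h2, h3, by omega⟩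
      · rintro (⟨⟨rfl, rfl⟩, rfl⟩ | ⟨h1, h2, h3, h4⟩)
        · exact ⟨h, rfl, rfl, le_rfl⟩
        · exact ⟨h1, h2, h3, by omega⟩
    rw [this, Finset.sum_insert (by simp), if_pos h]
    simp only
    ring
  · rw [if_neg h, sub_eq_zero]
    congr 1
    ext ⟨⟨a, b⟩, c⟩
    obtain ⟨y1, y2⟩ := y
    simp only [Finset.mem_filter]
    constructor
    · rintro ⟨h1, h2, h3, h4⟩
      refine ⟨h1, h2, h3, ?_⟩
      rcases eq_or_lt_of_le h4 with k | k
      · subst k; subst h3; subst h2; exact absurd h1 h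
      · omega
    · rintro ⟨h1, h2, h3, h4⟩
      exact ⟨h1, h2, h3, by omega⟩

lemma exists_bound : ∃ M : ℤ, 0 ≤ M ∧ ∀ e ∈ S, |e.1.1| < M ∧ |e.1.2| < M := by
  refine ⟨∑ e ∈ S, (|e.1.1| + |e.1.2| + 1), Finset.sum_nonneg fun e _ => by positivity, fun e he => ?_⟩
  have := Finset.single_le_sum (f := fun e : Edge => |e.1.1| + |e.1.2| + 1) (fun e _ => by positivity) he
  have h1 := abs_nonneg e.1.1
  have h2 := abs_nonneg e.1.2
  constructor <;> linarith

lemma psi_right {M : ℤ} (hM : ∀ e ∈ S, |e.1.1| < M ∧ |e.1.2| < M) (y : Site)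
    (hy : M ≤ y.1 ∨ M ≤ y.2 ∨ y.2 ≤ -M) : psi A S y = 0 := by
  unfold psi
  rw [Finset.filter_eq_empty_iff.2, Finset.sum_empty]
  rintro e he ⟨_, h2, h3⟩
  have := hM e he
  rw [abs_lt, abs_lt] at this
  omega

variable (hcl : ∀ e ∈ S, ∀ f ∈ bd A, Close e f → f ∈ S) (hSE : S ⊆ bd A)
include hcl hSE

lemma dS_plaq (q : Site) : (∀ g ∈ plaq q, dS A S g = dA A g) ∨ (∀ g ∈ plaq q, dS A S g = 0) := by
  by_cases h : ∃ e ∈ plaq q, e ∈ S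
  · left
    obtain ⟨e, h1, h2⟩ := h
    intro g hg
    unfold dS
    split_ifs with k
    · rfl
    · by_contra hc
      exact k (hcl e h2 g ((dA_ne A).1 (Ne.symm hc)) ⟨q, h1, hg⟩)
  · right
    push Not at h
    intro g hg
    simp [dS, h g hg]

lemma circ (q : Site) : dS A S (q, true) + dS A S ((q.1 + 1, q.2), false)
    = dS A S (q, false) + dS A S ((q.1, q.2 + 1), true) := by
  rcases dS_plaq A S hcl hSE q with h | h
  · rw [h _ (by simp [plaq]), h _ (by simp [plaq]), h _ (by simp [plaq]), h _ (by simp [plaq])]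
    simp [dA, tip]
  · rw [h _ (by simp [plaq]), h _ (by simp [plaq]), h _ (by simp [plaq]), h _ (by simp [plaq])]

lemma psi_v (y : Site) : psi A S y - psi A S (y.1, y.2 + 1) = dS A S (y, false) := by
  obtain ⟨M, hM0, hM⟩ := exists_bound S
  have key : ∀ n : ℕ, ∀ y : Site, M - n ≤ y.1 → psi A S y - psi A S (y.1, y.2 + 1) = dS A S (y, false) := by
    intro n
    induction n with
    | zero =>
      intro y hy
      rw [psi_right A S hM y (by left; simpa using hy), psi_right A S hM _ (by left; simpa using hy)]
      unfold dS
      rw [if_neg]; · rfl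
      intro hc
      have := hM _ hc
      rw [abs_lt] at this
      simp at hy this; omega
    | succ n ih =>
      intro y hy
      have h1 := ih (y.1 + 1, y.2) (by simp; push_cast at hy; linarith)
      have h2 := psi_h A S y
      have h3 := psi_h A S (y.1, y.2 + 1)
      have h4 := circ A S hcl hSE y
      simp only at h1 h2 h3 h4
      linarith
  exact key (M - y.1).toNat y (by have := Int.self_le_toNat (M - y.1); linarith)

lemma psi_d (e : Edge) : psi A S e.1 - psi A S (tip e) = dS A S e := by
  obtain ⟨y, b⟩ := e
  cases b
  · have := psi_v A S hcl hSE y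
    simpa [tip] using this
  · have := psi_h A S y
    simpa [tip] using this

lemma psi_left {M : ℤ} (hM : ∀ e ∈ S, |e.1.1| < M ∧ |e.1.2| < M) (y : Site)
    (hy : y.1 ≤ -M) : psi A S y = 0 := by
  have key : ∀ n : ℕ, ∀ y : Site, y.1 ≤ -M → M - n ≤ y.2 → psi A S y = 0 := by
    intro n
    induction n with
    | zero => intro y _ h; exact psi_right A S hM y (by right; left; simpa using h)
    | succ n ih =>
      intro y h1 h2
      have h3 := psi_v A S hcl hSE y
      rw [ih (y.1, y.2 + 1) h1 (by simp; push_cast at h2; linarith)] at h3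
      unfold dS at h3
      rw [if_neg] at h3
      · linarith
      · intro hc
        have := hM _ hc
        rw [abs_lt] at this
        simp at this; omega
  exact key (M - y.2).toNat y hy (by have := Int.self_le_toNat (M - y.2); linarith)

lemma psi_const {e f : Edge} (h : Close e f) (he : e ∈ S) (hf : f ∈ S) :
    psi A S e.1 - ind A e.1 = psi A S f.1 - ind A f.1 := by
  obtain ⟨q, h1, h2⟩ := h
  have hh : ∀ g ∈ plaq q, psi A S g.1 - ind A g.1 = psi A S (tip g) - ind A (tip g) := by
    intro g hg
    have h3 := psi_d A S hcl hSE g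
    have h4 : dS A S g = dA A g := by
      unfold dS
      split_ifs with k
      · rfl
      · by_contra hc
        exact k (hcl e he g ((dA_ne A).1 (Ne.symm hc)) ⟨q, h1, hg⟩)
    rw [h4] at h3
    unfold dA at h3
    linarith
  have hq : ∀ g ∈ plaq q, psi A S g.1 - ind A g.1 = psi A S q - ind A q := by
    have a1 := hh (q, true) (by simp [plaq])
    have a2 := hh (q, false) (by simp [plaq])
    intro g hg
    simp only [plaq, Finset.mem_insert, Finset.mem_singleton] at hg
    simp [tip] at a1 a2
    rcases hg with rfl | rfl | rfl | rfl
    · rfl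
    · rfl
    · simp; linarith
    · simp; linarith
  rw [hq e h1, hq f h2]

lemma psi_const' (hc : ∀ e ∈ S, ∀ f ∈ S, EConn S e f) {e f : Edge} (he : e ∈ S) (hf : f ∈ S) :
    psi A S e.1 - ind A e.1 = psi A S f.1 - ind A f.1 := by
  have := hc e he f hf
  clear hf
  induction this with
  | refl => rfl
  | tail _ h ih => rw [ih]; exact psi_const A S hcl hSE h.1 h.2.1 h.2.2

lemma psi_edge (y : Site) (hy : psi A S y ≠ 0) : ∃ e ∈ S, psi A S y = psi A S e.1 := by
  obtain ⟨M, hM0, hM⟩ := exists_bound S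
  have key : ∀ n : ℕ, ∀ y : Site, M - n ≤ y.1 → psi A S y ≠ 0 → ∃ e ∈ S, psi A S y = psi A S e.1 := by
    intro n
    induction n with
    | zero => intro y h h2; exact absurd (psi_right A S hM y (by left; simpa using h)) h2
    | succ n ih =>
      intro y h1 h2
      by_cases k : (y, true) ∈ S
      · exact ⟨_, k, rfl⟩
      · have h3 := psi_h A S y
        unfold dS at h3
        rw [if_neg k, sub_eq_zero] at h3
        rw [h3] at h2 ⊢
        exact ih _ (by simp; push_cast at h1; linarith) h2
  exact key (M - y.1).toNat y (by have := Int.self_le_toNat (M - y.1); linarith) hy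

lemma ctr_of_psi (hc : ∀ e ∈ S, ∀ f ∈ S, EConn S e f) (x : Site) (hx : 1 ≤ psi A S x) :
    ∃ C, Ctr x C ∧ ∀ e ∈ bd C, inn C e ∈ A ∧ out C e ∉ A := by
  obtain ⟨M, hM0, hM⟩ := exists_bound S
  obtain ⟨e0, he0, hxe⟩ := psi_edge A S hcl hSE x (by omega)
  have hne : (S.filter (fun e => e.2 = true)).Nonempty := by
    by_contra hn
    rw [Finset.not_nonempty_iff_eq_empty, Finset.filter_eq_empty_iff] at hn
    have : psi A S x = 0 := by
      unfold psi
      rw [Finset.filter_eq_empty_iff.2, Finset.sum_empty]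
      rintro e he ⟨h, _⟩
      exact hn he h
    omega
  obtain ⟨f, hf, hmax⟩ := Finset.exists_max_image _ (fun e : Edge => e.1.1) hne
  rw [Finset.mem_filter] at hf
  have hft : psi A S (tip f) = 0 := by
    unfold psi
    rw [Finset.filter_eq_empty_iff.2, Finset.sum_empty]
    rintro e he ⟨h, h1, h2⟩
    have := hmax e (Finset.mem_filter.2 ⟨he, h⟩)
    simp [tip, hf.2] at h2
    omega
  have hdf : dS A S f = dA A f := by unfold dS; rw [if_pos hf.1]
  have hf2 := psi_d A S hcl hSE f
  rw [hdf, hft] at hf2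
  unfold dA at hf2
  have hc0 := psi_const' A S hcl hSE hc he0 hf.1
  have hind : ∀ y, ind A y = 0 ∨ ind A y = 1 := by intro y; unfold ind; split_ifs <;> simp
  have hs0 : ∀ e ∈ S, psi A S e.1 = ind A e.1 := by
    intro e he
    have h1 := psi_const' A S hcl hSE hc he he0
    rcases hind e0.1 with h | h <;> rcases hind (tip f) with h' | h' <;> omega
  have hs1 : ∀ e ∈ S, psi A S (tip e) = ind A (tip e) := by
    intro e he
    have h1 := hs0 e he
    have h2 := psi_d A S hcl hSE e
    unfold dS dA at h2
    rw [if_pos he] at h2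
    omega
  have h01 : ∀ y, psi A S y = 0 ∨ psi A S y = 1 := by
    intro y
    by_cases k : psi A S y = 0
    · left; exact k
    · obtain ⟨e, he, h⟩ := psi_edge A S hcl hSE y k
      rw [h, hs0 e he]; exact hind _
  set C : Finset Site := ((Finset.Icc (-M) M) ×ˢ (Finset.Icc (-M) M)).filter (fun y => psi A S y = 1) with hC
  have hmC : ∀ y, y ∈ C ↔ psi A S y = 1 := by
    intro y
    rw [hC, Finset.mem_filter, and_iff_right_iff_imp]
    intro h
    rw [Finset.mem_product, Finset.mem_Icc, Finset.mem_Icc]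
    have h1 : ¬ (M ≤ y.1 ∨ M ≤ y.2 ∨ y.2 ≤ -M) := fun k => by
      rw [psi_right A S hM y k] at h; omega
    have h2 : ¬ (y.1 ≤ -M) := fun k => by
      rw [psi_left A S hcl hSE hM y k] at h; omega
    omega
  have hbd : bd C = S := by
    ext e
    rw [mem_bd, hmC, hmC]
    have h1 := psi_d A S hcl hSE e
    unfold dS at h1
    by_cases k : e ∈ S
    · rw [if_pos k] at h1
      have := (dA_ne A).2 (hSE k)
      refine iff_of_true ?_ k
      rcases h01 e.1 with h | h <;> rcases h01 (tip e) with h' | h' <;> rw [h, h'] <;> omega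
    · rw [if_neg k, sub_eq_zero] at h1
      rw [h1]; simp [k]
  refine ⟨C, ⟨(hmC x).2 ?_, ?_⟩, ?_⟩
  · rcases h01 x with h | h <;> omega
  · rw [hbd]; exact hc
  · intro e he
    have hi := inn_mem he
    have ho := out_mem he
    rw [hbd] at he
    rw [hmC] at hi ho
    have q : ∀ y, (y = e.1 ∨ y = tip e) → (psi A S y = 1 ↔ y ∈ A) := by
      rintro y (rfl | rfl)
      · rw [hs0 e he]; unfold ind; simp
      · rw [hs1 e he]; unfold ind; simp
    constructor
    · rw [← q]; · exact hi
      unfold inn; split_ifs <;> simp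
    · rw [← q]; · exact ho
      unfold out; split_ifs <;> simp

end ctr

lemma exists_ctr (A : Finset Site) (x : Site) (hx : x ∈ A) :
    ∃ C, Ctr x C ∧ ∀ e ∈ bd C, inn C e ∈ A ∧ out C e ∉ A := by
  set E := bd A with hE
  set cls : Edge → Finset Edge := fun e => E.filter (fun f => EConn E e f) with hcls
  -- psi of the whole boundary
  have hfull : ∀ e ∈ E, ∀ f ∈ bd A, Close e f → f ∈ E := fun e _ f hf _ => hf
  have hpsiE : psi A E x = 1 := by
    obtain ⟨M, hM0, hM⟩ := exists_bound E
    have hdS : ∀ e, dS A E e = dA A e := by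
      intro e; unfold dS
      split_ifs with k
      · rfl
      · by_contra hc; exact k ((dA_ne A).1 (Ne.symm hc))
    obtain ⟨M', hM'⟩ : ∃ M' : ℤ, M ≤ M' ∧ ∀ y ∈ A, y.1 < M' := by
      refine ⟨M + ∑ y ∈ A, (|y.1| + 1), ?_, ?_⟩
      · have : 0 ≤ ∑ y ∈ A, (|y.1| + 1) := Finset.sum_nonneg fun e _ => by positivity
        linarith
      · intro y hy
        have := Finset.single_le_sum (f := fun y : Site => |y.1| + 1) (fun e _ => by positivity) hy
        linarith [le_abs_self y.1]
    have key : ∀ n : ℕ, ∀ y : Site, M' - n ≤ y.1 → psi A E y = ind A y := by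
      intro n
      induction n with
      | zero =>
        intro y hy
        rw [psi_right A E hM y (by left; simp at hy; linarith)]
        unfold ind; rw [if_neg]
        intro hc
        have := hM'.2 y hc
        simp at hy; omega
      | succ n ih =>
        intro y hy
        have h1 := psi_h A E y
        rw [hdS, ih (y.1 + 1, y.2) (by simp; push_cast at hy; linarith)] at h1
        simp [dA, tip] at h1
        exact h1
    rw [key (M' - x.1).toNat x (by have := Int.self_le_toNat (M' - x.1); linarith)]
    simp [ind, hx]
  have hcls_eq : ∀ e ∈ E, ∀ f ∈ E, (cls f = cls e ↔ f ∈ cls e) := by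
    intro e he f hf
    constructor
    · intro h
      rw [← h, hcls, Finset.mem_filter]; exact ⟨hf, Relation.ReflTransGen.refl⟩
    · intro h
      have h' : EConn E e f := (Finset.mem_filter.1 h).2
      ext g
      simp only [hcls, Finset.mem_filter]
      exact ⟨fun k => ⟨k.1, h'.trans k.2⟩, fun k => ⟨k.1, h'.symm.trans k.2⟩⟩
  obtain ⟨e0, he0, hpos⟩ : ∃ e0 ∈ E, 1 ≤ psi A (cls e0) x := by
    by_contra hcon
    push Not at hcon
    have h1 : psi A E x = ∑ S ∈ E.image cls, ∑ e ∈ (E.filter (fun e => e.2 = true ∧ e.1.2 = x.2 ∧ x.1 ≤ e.1.1)).filter (fun e => cls e = S), dA A e := by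
      unfold psi
      rw [Finset.sum_fiberwise_of_maps_to]
      intro e he
      exact Finset.mem_image_of_mem _ (Finset.mem_filter.1 he).1
    have h2 : ∑ S ∈ E.image cls, ∑ e ∈ (E.filter (fun e => e.2 = true ∧ e.1.2 = x.2 ∧ x.1 ≤ e.1.1)).filter (fun e => cls e = S), dA A e ≤ 0 := by
      apply Finset.sum_nonpos
      intro S hS
      obtain ⟨e, he, rfl⟩ := Finset.mem_image.1 hS
      have := hcon e he
      have heq : (E.filter (fun e => e.2 = true ∧ e.1.2 = x.2 ∧ x.1 ≤ e.1.1)).filter (fun f => cls f = cls e)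
        = (cls e).filter (fun e => e.2 = true ∧ e.1.2 = x.2 ∧ x.1 ≤ e.1.1) := by
        ext f
        simp only [Finset.mem_filter]
        constructor
        · rintro ⟨⟨h1, h2⟩, h3⟩
          exact ⟨(hcls_eq e he f h1).1 h3, h2⟩
        · rintro ⟨h1, h2⟩
          have hf : f ∈ E := (Finset.mem_filter.1 h1).1
          exact ⟨⟨hf, h2⟩, (hcls_eq e he f hf).2 h1⟩
      rw [heq]
      unfold psi at this
      omega
    omega
  have hsub : cls e0 ⊆ bd A := Finset.filter_subset _ _
  refine ctr_of_psi A (cls e0) ?_ hsub ?_ x hpos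
  · intro e he f hf hef
    have := Finset.mem_filter.1 he
    refine Finset.mem_filter.2 ⟨hf, this.2.tail ⟨hef, this.1, hf⟩⟩
  · have h0 : ∀ e, EConn E e0 e → EConn (cls e0) e0 e := by
      intro e h
      induction h with
      | refl => exact Relation.ReflTransGen.refl
      | tail h1 h2 ih =>
        refine ih.tail ⟨h2.1, ?_, ?_⟩
        · exact Finset.mem_filter.2 ⟨h2.2.1, h1⟩
        · exact Finset.mem_filter.2 ⟨h2.2.2, h1.tail h2⟩
    intro e he f hf
    exact (h0 e (Finset.mem_filter.1 he).2).symm.trans (h0 f (Finset.mem_filter.1 hf).2)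

end

section

lemma close_lip {e f : Edge} (h : Close e f) :
    -1 ≤ f.1.1 - e.1.1 ∧ f.1.1 - e.1.1 ≤ 1 ∧ -1 ≤ f.1.2 - e.1.2 ∧ f.1.2 - e.1.2 ≤ 1 := by
  obtain ⟨q, h1, h2⟩ := h
  simp only [plaq, Finset.mem_insert, Finset.mem_singleton] at h1 h2
  rcases h1 with rfl | rfl | rfl | rfl <;> rcases h2 with rfl | rfl | rfl | rfl <;> simp

lemma econn_range {S : Finset Edge} {e f : Edge} (φ : Edge → ℤ)
    (hφ : ∀ a b, Close a b → φ b - φ a ≤ 1) (he : e ∈ S) (h : EConn S e f) :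
    φ f - φ e + 1 ≤ S.card := by
  have key : ∀ v, φ e ≤ v → v ≤ φ f → ∃ g ∈ S, φ g = v := by
    induction h with
    | refl => intro v h1 h2; exact ⟨e, he, le_antisymm h1 h2⟩
    | tail h1 h2 ih =>
      rename_i b c
      intro v h3 h4
      by_cases k : v ≤ φ b
      · exact ih v h3 k
      · have := hφ _ _ h2.1
        exact ⟨c, h2.2.2, by omega⟩
  have hsub : Finset.Icc (φ e) (φ f) ⊆ S.image φ := by
    intro v hv
    rw [Finset.mem_Icc] at hv
    obtain ⟨g, hg, rfl⟩ := key v hv.1 hv.2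
    exact Finset.mem_image_of_mem _ hg
  have h1 := (Finset.card_le_card hsub).trans Finset.card_image_le
  rw [Int.card_Icc] at h1
  have := Int.self_le_toNat (φ f + 1 - φ e)
  omega

lemma right_exit {C : Finset Site} {y : Site} (hy : y ∈ C) :
    ∃ a : ℤ, y.1 ≤ a ∧ (a, y.2) ∈ C ∧ ((a, y.2), true) ∈ bd C := by
  obtain ⟨f, hf, hm⟩ := Finset.exists_max_image (C.filter (fun z => z.2 = y.2)) (fun z => z.1) ⟨y, by simp [hy]⟩
  rw [Finset.mem_filter] at hf
  have e : (f.1, y.2) = f := by rw [← hf.2]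
  refine ⟨f.1, hm y (by simp [hy]), by rw [e]; exact hf.1, ?_⟩
  rw [mem_bd, e]
  simp only [tip, if_true]
  intro h
  have := hm _ (Finset.mem_filter.2 ⟨h.1 hf.1, hf.2⟩)
  simp at this

lemma left_exit {C : Finset Site} {y : Site} (hy : y ∈ C) :
    ∃ a : ℤ, a < y.1 ∧ (a + 1, y.2) ∈ C ∧ ((a, y.2), true) ∈ bd C := by
  obtain ⟨f, hf, hm⟩ := Finset.exists_min_image (C.filter (fun z => z.2 = y.2)) (fun z => z.1) ⟨y, by simp [hy]⟩
  rw [Finset.mem_filter] at hf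
  have e : (f.1 - 1 + 1, y.2) = f := by rw [← hf.2]; simp
  have h1 := hm y (by simp [hy])
  refine ⟨f.1 - 1, by omega, by rw [e]; exact hf.1, ?_⟩
  rw [mem_bd]
  simp only [tip, if_true, e]
  intro h
  have := hm _ (Finset.mem_filter.2 ⟨h.2 hf.1, rfl⟩)
  simp at this

lemma ctr_box {x : Site} {C : Finset Site} (h : Ctr x C) {y : Site} (hy : y ∈ C) :
    |y.1 - x.1| ≤ (bd C).card ∧ |y.2 - x.2| ≤ (bd C).card := by
  obtain ⟨a, ha, _, ha'⟩ := right_exit hy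
  obtain ⟨b, hb, _, hb'⟩ := left_exit hy
  obtain ⟨c, hc, _, hc'⟩ := right_exit h.1
  obtain ⟨d, hd, _, hd'⟩ := left_exit h.1
  have l1 : ∀ a b : Edge, Close a b → b.1.1 - a.1.1 ≤ 1 := fun a b h => (close_lip h).2.1
  have l2 : ∀ a b : Edge, Close a b → b.1.2 - a.1.2 ≤ 1 := fun a b h => (close_lip h).2.2.2
  have k1 := econn_range (fun e => e.1.1) l1 hb' (h.2 _ hb' _ hc')
  have k2 := econn_range (fun e => e.1.1) l1 hd' (h.2 _ hd' _ ha')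
  have k3 := econn_range (fun e => e.1.2) l2 hb' (h.2 _ hb' _ hc')
  have k4 := econn_range (fun e => e.1.2) l2 hd' (h.2 _ hd' _ ha')
  simp only at k1 k2 k3 k4
  rw [abs_le, abs_le]
  omega

lemma bd_pos {x : Site} {C : Finset Site} (h : x ∈ C) : 1 ≤ (bd C).card := by
  obtain ⟨a, ha, _, ha'⟩ := right_exit h
  exact Finset.card_pos.2 ⟨_, ha'⟩

lemma ctr_anchor {x : Site} {C : Finset Site} (h : Ctr x C) :
    ∃ a : ℕ, a ≤ (bd C).card ∧ ((x.1 + a, x.2), true) ∈ bd C := by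
  obtain ⟨c, hc, _, hc'⟩ := right_exit h.1
  obtain ⟨d, hd, _, hd'⟩ := left_exit h.1
  have l1 : ∀ a b : Edge, Close a b → b.1.1 - a.1.1 ≤ 1 := fun a b h => (close_lip h).2.1
  have k1 := econn_range (fun e => e.1.1) l1 hd' (h.2 _ hd' _ hc')
  simp only at k1
  refine ⟨(c - x.1).toNat, by omega, ?_⟩
  rw [Int.toNat_of_nonneg (by omega)]
  simpa using hc'

lemma bd_inj {C C' : Finset Site} (h : bd C = bd C') : C = C' := by
  obtain ⟨M, hM⟩ : ∃ M : ℤ, ∀ y ∈ C ∪ C', y.1 < M := by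
    refine ⟨∑ y ∈ C ∪ C', (|y.1| + 1), ?_⟩
    intro y hy
    have := Finset.single_le_sum (f := fun y : Site => |y.1| + 1) (fun e _ => by positivity) hy
    linarith [le_abs_self y.1]
  have key : ∀ n : ℕ, ∀ y : Site, M - n ≤ y.1 → (y ∈ C ↔ y ∈ C') := by
    intro n
    induction n with
    | zero =>
      intro y hy
      have : y ∉ C ∪ C' := fun k => by have := hM y k; simp at hy; omega
      rw [Finset.mem_union] at this
      tauto
    | succ n ih =>
      intro y hy
      have h1 := ih (y.1 + 1, y.2) (by simp; push_cast at hy; linarith)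
      have h2 : (y, true) ∈ bd C ↔ (y, true) ∈ bd C' := by rw [h]
      rw [mem_bd, mem_bd] at h2
      simp only [tip, if_true] at h2
      tauto
  ext y
  exact key (M - y.1).toNat y (by have := Int.self_le_toNat (M - y.1); linarith)

abbrev Lab : Type := Fin 3 × Fin 3 × Bool
def nb (l : Lab) (e : Edge) : Edge := ((e.1.1 + ((l.1 : ℕ) : ℤ) - 1, e.1.2 + ((l.2.1 : ℕ) : ℤ) - 1), l.2.2)

lemma close_nb {e f : Edge} (h : Close e f) : ∃ l, nb l e = f := by
  obtain ⟨h1, h2, h3, h4⟩ := close_lip h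
  refine ⟨(⟨(f.1.1 - e.1.1 + 1).toNat, by omega⟩, ⟨(f.1.2 - e.1.2 + 1).toNat, by omega⟩, f.2), ?_⟩
  obtain ⟨⟨a, b⟩, c⟩ := f
  simp only [nb, Prod.mk.injEq, and_true]
  simp only at h1 h2 h3 h4
  rw [Int.toNat_of_nonneg (by omega), Int.toNat_of_nonneg (by omega)]
  constructor <;> ring

def vis : Edge → List Lab → Finset Edge
  | e, [] => {e}
  | e, l :: w => insert e (vis (nb l e) w)

lemma vis_self (e : Edge) (w : List Lab) : e ∈ vis e w := by cases w <;> simp [vis]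

lemma vis_detour {e f g : Edge} {w : List Lab} (hf : f ∈ vis e w) (h : Close f g) :
    ∃ w', w'.length = w.length + 2 ∧ vis e w' = insert g (vis e w) := by
  induction w generalizing e with
  | nil =>
    simp [vis] at hf
    subst hf
    obtain ⟨i, hi⟩ := close_nb h
    obtain ⟨j, hj⟩ := close_nb h.symm
    refine ⟨[i, j], rfl, ?_⟩
    ext a
    simp only [vis, hi, hj, Finset.mem_insert, Finset.mem_singleton]
    tauto
  | cons l w ih =>
    simp only [vis, Finset.mem_insert] at hf
    rcases hf with rfl | hf
    · obtain ⟨i, hi⟩ := close_nb h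
      obtain ⟨j, hj⟩ := close_nb h.symm
      refine ⟨i :: j :: l :: w, by simp, ?_⟩
      ext a
      simp only [vis, hi, hj, Finset.mem_insert]
      tauto
    · obtain ⟨w', h1, h2⟩ := ih hf
      refine ⟨l :: w', by simp [h1], ?_⟩
      simp only [vis, h2]
      ext a
      simp only [Finset.mem_insert]
      tauto

lemma econn_cross {S : Finset Edge} {e g : Edge} (h : EConn S e g) (T : Finset Edge) (he : e ∈ T) (hg : g ∉ T) :
    ∃ a b, a ∈ T ∧ b ∉ T ∧ b ∈ S ∧ Close a b := by
  induction h with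
  | refl => exact absurd he hg
  | tail h1 h2 ih =>
    rename_i b c
    by_cases k : b ∈ T
    · exact ⟨b, c, k, hg, h2.2.2, h2.1⟩
    · exact ih k

lemma cover {S : Finset Edge} {e : Edge} (he : e ∈ S) (hc : ∀ f ∈ S, EConn S e f) :
    ∃ w : List Lab, w.length ≤ 2 * S.card ∧ vis e w = S := by
  have key : ∀ m : ℕ, m + 1 ≤ S.card → ∃ w : List Lab, w.length = 2 * m ∧ vis e w ⊆ S ∧ (vis e w).card = m + 1 := by
    intro m
    induction m with
    | zero => intro _; exact ⟨[], rfl, by simpa [vis] using he, by simp [vis]⟩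
    | succ m ih =>
      intro hm
      obtain ⟨w, h1, h2, h3⟩ := ih (by omega)
      obtain ⟨g, hg, hg'⟩ : ∃ g ∈ S, g ∉ vis e w := by
        by_contra hcon
        push Not at hcon
        have := Finset.card_le_card (show S ⊆ vis e w from hcon)
        omega
      obtain ⟨a, b, ha, hb, hbS, hab⟩ := econn_cross (hc g hg) _ (vis_self e w) hg'
      obtain ⟨w', h4, h5⟩ := vis_detour ha hab
      refine ⟨w', by omega, ?_, ?_⟩
      · rw [h5]; exact Finset.insert_subset hbS h2
      · rw [h5, Finset.card_insert_of_notMem hb, h3]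
  have hpos : 1 ≤ S.card := Finset.card_pos.2 ⟨e, he⟩
  obtain ⟨w, h1, h2, h3⟩ := key (S.card - 1) (by omega)
  exact ⟨w, by omega, Finset.eq_of_subset_of_card_le h2 (by omega)⟩

open ENNReal

lemma tsum_list (t : ℝ≥0∞) (ht : t ≤ 1/36) : ∑' w : List Lab, t ^ w.length ≤ 2 := by
  rw [← (Equiv.sigmaFiberEquiv (List.length : List Lab → ℕ)).tsum_eq, ENNReal.tsum_sigma']
  have : ∀ n : ℕ, ∑' w : {w : List Lab // w.length = n}, t ^ ((Equiv.sigmaFiberEquiv (List.length : List Lab → ℕ)) ⟨n, w⟩).length ≤ (1/2)^n := by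
    intro n
    have h1 : ∀ w : {w : List Lab // w.length = n}, t ^ ((Equiv.sigmaFiberEquiv (List.length : List Lab → ℕ)) ⟨n, w⟩).length = t^n := by
      rintro ⟨w, hw⟩
      simp [Equiv.sigmaFiberEquiv, hw]
    simp_rw [h1]
    have : Fintype {w : List Lab // w.length = n} := inferInstanceAs (Fintype (List.Vector Lab n))
    rw [tsum_fintype, Finset.sum_const, nsmul_eq_mul, Finset.card_univ]
    have hc : Fintype.card {w : List Lab // w.length = n} = 18 ^ n := by
      have := card_vector (α := Lab) n
      rw [show Fintype.card Lab = 18 by simp] at this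
      rw [← this]; exact Fintype.card_congr (Equiv.refl _)
    rw [hc]
    push_cast
    rw [← mul_pow]
    gcongr
    calc (18:ℝ≥0∞) * t ≤ 18 * (1/36) := by gcongr
      _ = 1/2 := by
        rw [← ENNReal.toReal_eq_toReal_iff' (by finiteness) (by finiteness)]
        simp; norm_num
  refine (ENNReal.tsum_le_tsum this).trans ?_
  rw [ENNReal.tsum_geometric]
  simp

def b0 : ℝ := 3 * Real.log 36 + Real.log 4

lemma b0_pos : 0 < b0 := by
  unfold b0
  have h1 := Real.log_pos (show (1:ℝ) < 36 by norm_num)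
  have h2 := Real.log_pos (show (1:ℝ) < 4 by norm_num)
  linarith

lemma ctr_sum (x : Site) :
    ∑' C : Finset Site, (if Ctr x C then ENNReal.ofReal (Real.exp (-b0 * (bd C).card)) else 0) ≤ 1 := by
  have hex : ∀ C : {C // Ctr x C}, ∃ q : ℕ × List Lab, q.1 ≤ (bd C.1).card ∧ q.2.length ≤ 2 * (bd C.1).card ∧
      vis ((x.1 + q.1, x.2), true) q.2 = bd C.1 := by
    rintro ⟨C, hC⟩
    obtain ⟨a, ha, ha'⟩ := ctr_anchor hC
    obtain ⟨w, h1, h2⟩ := cover ha' (fun f hf => hC.2 _ ha' f hf)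
    exact ⟨(a, w), ha, h1, h2⟩
  choose enc he1 he2 he3 using hex
  have hinj : Function.Injective enc := by
    intro C C' h
    have h1 := he3 C
    rw [h, he3 C'] at h1
    exact Subtype.ext (bd_inj h1.symm)
  have hs : ∑' C : Finset Site, (if Ctr x C then ENNReal.ofReal (Real.exp (-b0 * (bd C).card)) else 0)
    = ∑' C : {C // Ctr x C}, ENNReal.ofReal (Real.exp (-b0 * (bd C.1).card)) := by
    rw [show (∑' C : {C // Ctr x C}, ENNReal.ofReal (Real.exp (-b0 * (bd C.1).card))) = ∑' C : ({C | Ctr x C} : Set (Finset Site)), ENNReal.ofReal (Real.exp (-b0 * (bd C.1).card)) from rfl, tsum_subtype {C | Ctr x C} (fun C => ENNReal.ofReal (Real.exp (-b0 * (bd C).card)))]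
    rfl
  rw [hs]
  have hle : ∀ C : {C // Ctr x C}, ENNReal.ofReal (Real.exp (-b0 * (bd C.1).card)) ≤
      (fun q : ℕ × List Lab => (1/4 : ℝ≥0∞) * ((1/36)^q.1 * (1/36)^q.2.length)) (enc C) := by
    intro C
    have h1 := he1 C
    have h2 := he2 C
    have h3 := bd_pos C.2.1
    set n := (bd C.1).card
    have e1 : Real.exp (-b0 * n) = (1/36)^(3*n) * (1/4)^n := by
      unfold b0
      rw [show -(3 * Real.log 36 + Real.log 4) * (n:ℝ) = ((3*n:ℕ):ℝ) * (-Real.log 36) + (n:ℝ) * (- Real.log 4) by push_cast; ring]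
      rw [Real.exp_add, Real.exp_nat_mul, Real.exp_nat_mul, Real.exp_neg, Real.exp_neg, Real.exp_log (by norm_num), Real.exp_log (by norm_num)]
      simp
    have e2 : Real.exp (-b0 * n) ≤ (1/4) * ((1/36)^(enc C).1 * (1/36)^(enc C).2.length) := by
      rw [e1, ← pow_add, mul_comm]
      apply mul_le_mul
      · calc ((1:ℝ)/4)^n ≤ (1/4)^1 := pow_le_pow_of_le_one (by norm_num) (by norm_num) h3
          _ = 1/4 := by norm_num
      · exact pow_le_pow_of_le_one (by norm_num) (by norm_num) (by omega)
      · positivity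
      · norm_num
    refine (ENNReal.ofReal_le_ofReal e2).trans (le_of_eq ?_)
    rw [ENNReal.ofReal_mul (by norm_num), ENNReal.ofReal_mul (by positivity), ENNReal.ofReal_pow (by norm_num), ENNReal.ofReal_pow (by norm_num)]
    rw [ENNReal.ofReal_div_of_pos (by norm_num), ENNReal.ofReal_div_of_pos (by norm_num)]
    simp
  refine (ENNReal.tsum_le_tsum hle).trans ((ENNReal.tsum_comp_le_tsum_of_injective hinj (fun q : ℕ × List Lab => (1/4 : ℝ≥0∞) * ((1/36)^q.1 * (1/36)^q.2.length))).trans ?_)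
  rw [ENNReal.tsum_mul_left, ENNReal.tsum_prod']
  simp_rw [ENNReal.tsum_mul_left]
  rw [ENNReal.tsum_mul_right]
  have h1 := tsum_list (1/36) le_rfl
  have h2 : ∑' n : ℕ, (1/36 : ℝ≥0∞)^n ≤ 2 := by
    calc ∑' n : ℕ, (1/36 : ℝ≥0∞)^n ≤ ∑' n : ℕ, (1/2)^n := by
          apply ENNReal.tsum_le_tsum; intro n; gcongr; norm_num
      _ ≤ 2 := by rw [ENNReal.tsum_geometric]; simp
  calc _ ≤ (1/4 : ℝ≥0∞) * (2 * 2) := by gcongr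
    _ = 1 := by
      rw [← ENNReal.toReal_eq_toReal_iff' (by finiteness) (by finiteness)]
      simp; norm_num

end

section
open ENNReal NNReal

open scoped FinsetFamily in
lemma four_tsum {α : Type*} [DistribLattice α] (f1 f2 f3 f4 : α → ℝ≥0)
    (h : ∀ a b, f1 a * f2 b ≤ f3 (a ⊓ b) * f4 (a ⊔ b)) :
    (∑' a, (f1 a : ℝ≥0∞)) * (∑' a, (f2 a : ℝ≥0∞)) ≤ (∑' a, (f3 a : ℝ≥0∞)) * (∑' a, (f4 a : ℝ≥0∞)) := by
  rw [ENNReal.tsum_eq_iSup_sum (f := fun a => (f1 a : ℝ≥0∞)), ENNReal.tsum_eq_iSup_sum (f := fun a => (f2 a : ℝ≥0∞))]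
  rw [ENNReal.iSup_mul]
  refine iSup_le fun s => ?_
  rw [ENNReal.mul_iSup]
  refine iSup_le fun t => ?_
  have := four_functions_theorem (β := ℝ≥0) f1 f2 f3 f4 (fun _ => zero_le) (fun _ => zero_le) (fun _ => zero_le) (fun _ => zero_le) h s t
  calc (∑ a ∈ s, (f1 a : ℝ≥0∞)) * ∑ a ∈ t, (f2 a : ℝ≥0∞) = (((∑ a ∈ s, f1 a) * ∑ a ∈ t, f2 a : ℝ≥0) : ℝ≥0∞) := by push_cast; rfl
    _ ≤ (((∑ a ∈ s ⊼ t, f3 a) * ∑ a ∈ s ⊻ t, f4 a : ℝ≥0) : ℝ≥0∞) := by exact_mod_cast this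
    _ = (∑ a ∈ s ⊼ t, (f3 a : ℝ≥0∞)) * ∑ a ∈ s ⊻ t, (f4 a : ℝ≥0∞) := by push_cast; rfl
    _ ≤ _ := mul_le_mul' (ENNReal.sum_le_tsum _) (ENNReal.sum_le_tsum _)

def wtN (p β : ℝ) (η : Site → ℤ) : ℝ≥0 := Real.toNNReal (Real.exp (-β * pH p η))
lemma wtN_coe (p β : ℝ) (η : Site → ℤ) : (wtN p β η : ℝ≥0∞) = wt p β η := rfl

lemma wtN_mul {p β : ℝ} (hβ : 0 ≤ β) {a b c d : Site → ℤ} (h : pH p c + pH p d ≤ pH p a + pH p b) :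
    wtN p β a * wtN p β b ≤ wtN p β c * wtN p β d := by
  unfold wtN
  rw [← Real.toNNReal_mul (Real.exp_nonneg _), ← Real.toNNReal_mul (Real.exp_nonneg _), ← Real.exp_add, ← Real.exp_add]
  apply Real.toNNReal_le_toNNReal
  apply Real.exp_le_exp.2
  nlinarith

lemma pH_minmax {p : ℝ} (hp : 2 < p) {D : Finset Site} {η η' : Site → ℤ} (h : Supp D η) (h' : Supp D η') {k : ℤ} (hk : 0 ≤ k) :
    pH p (fun x => min (η x) (η' x + k)) + pH p (fun x => max (η x - k) (η' x)) ≤ pH p η + pH p η' := by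
  have h1 : Supp D (fun x => min (η x) (η' x + k)) := fun x hx => by simp [h x hx, h' x hx, hk]
  have h2 : Supp D (fun x => max (η x - k) (η' x)) := fun x hx => by simp [h x hx, h' x hx, hk]
  rw [pH_sum hp h (Ed D) (fun e => mem_Ed), pH_sum hp h' (Ed D) (fun e => mem_Ed), pH_sum hp h1 (Ed D) (fun e => mem_Ed),
    pH_sum hp h2 (Ed D) (fun e => mem_Ed), ← Finset.sum_add_distrib, ← Finset.sum_add_distrib]
  apply Finset.sum_le_sum
  intro e _
  have := V_minmax hp (η e.1) (η (tip e)) (η' e.1 + k) (η' (tip e) + k)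
  have e1 : max (η e.1 - k) (η' e.1) - max (η (tip e) - k) (η' (tip e)) = max (η e.1) (η' e.1 + k) - max (η (tip e)) (η' (tip e) + k) := by
    rw [show max (η e.1) (η' e.1 + k) = max (η e.1 - k) (η' e.1) + k by rw [← max_add_add_right]; simp,
      show max (η (tip e)) (η' (tip e) + k) = max (η (tip e) - k) (η' (tip e)) + k by rw [← max_add_add_right]; simp]
    ring
  rw [e1]
  rw [show η' e.1 + k - (η' (tip e) + k) = η' e.1 - η' (tip e) by ring] at this
  exact this

lemma W_coe (p β : ℝ) (D : Finset Site) (A : (Site → ℤ) → Prop) :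
    W p β D A = ∑' η, ((if Supp D η ∧ A η then wtN p β η else 0 : ℝ≥0) : ℝ≥0∞) := by
  unfold W
  congr 1; funext η
  split_ifs
  · rfl
  · rfl

lemma W_shift {p β : ℝ} (hp : 2 < p) (hβ : 0 ≤ β) {D : Finset Site} {X Y Z Z' : (Site → ℤ) → Prop} (k : ℤ) (hk : 0 ≤ k)
    (h : ∀ η η', X η → Y η' → Z (fun x => min (η x) (η' x + k)) ∧ Z' (fun x => max (η x - k) (η' x))) :
    W p β D X * W p β D Y ≤ W p β D Z * W p β D Z' := by
  have key := four_tsum (α := Site → ℤ)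
    (fun η => if Supp D η ∧ X η then wtN p β η else 0)
    (fun ζ => (fun η => if Supp D η ∧ Y η then wtN p β η else 0) (ζ - fun _ => k))
    (fun η => if Supp D η ∧ Z η then wtN p β η else 0)
    (fun ζ => (fun η => if Supp D η ∧ Z' η then wtN p β η else 0) (ζ - fun _ => k)) ?_
  · have sh : ∀ f : (Site → ℤ) → ℝ≥0∞, ∑' ζ : Site → ℤ, f (ζ - fun _ => k) = ∑' ζ, f ζ := by
      intro f
      exact (Equiv.subRight (fun _ : Site => k)).tsum_eq f
    rw [sh (fun η => ((if Supp D η ∧ Y η then wtN p β η else 0 : ℝ≥0) : ℝ≥0∞)),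
      sh (fun η => ((if Supp D η ∧ Z' η then wtN p β η else 0 : ℝ≥0) : ℝ≥0∞)),
      ← W_coe, ← W_coe, ← W_coe, ← W_coe] at key
    exact key
  · intro η ζ
    simp only
    by_cases k1 : Supp D η ∧ X η
    · by_cases k2 : Supp D (ζ - fun _ => k) ∧ Y (ζ - fun _ => k)
      · set η' := ζ - fun _ => k with hη'
        have e1 : η ⊓ ζ = fun x => min (η x) (η' x + k) := by
          funext x; simp [hη']
        have e2 : (η ⊔ ζ) - (fun _ => k) = fun x => max (η x - k) (η' x) := by
          funext x; simp [hη', max_sub_sub_right]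
        rw [e1, e2]
        have h1 : Supp D (fun x => min (η x) (η' x + k)) := fun x hx => by simp [k1.1 x hx, k2.1 x hx, hk]
        have h2 : Supp D (fun x => max (η x - k) (η' x)) := fun x hx => by simp [k1.1 x hx, k2.1 x hx, hk]
        have h3 := h η η' k1.2 k2.2
        rw [if_pos k1, if_pos k2, if_pos ⟨h1, h3.1⟩, if_pos ⟨h2, h3.2⟩]
        exact wtN_mul hβ (pH_minmax hp k1.1 k2.1 hk)
      · rw [if_neg k2]; simp
    · rw [if_neg k1]; simp

/-- swap lemma -/
def glue (U : Finset Site) (q : ({x // x ∈ U} → ℤ) × ({x // ¬ x ∈ U} → ℤ)) : Site → ℤ :=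
  fun x => if h : x ∈ U then q.1 ⟨x, h⟩ else q.2 ⟨x, h⟩

lemma W_glue (p β : ℝ) (D : Finset Site) (A : (Site → ℤ) → Prop) (U : Finset Site) :
    W p β D A = ∑' ζ : {x // ¬ x ∈ U} → ℤ, ∑' ξ : {x // x ∈ U} → ℤ,
      ((if Supp D (glue U (ξ, ζ)) ∧ A (glue U (ξ, ζ)) then wtN p β (glue U (ξ, ζ)) else 0 : ℝ≥0) : ℝ≥0∞) := by
  rw [W_coe, ← (Equiv.piEquivPiSubtypeProd (fun x => x ∈ U) (fun _ => ℤ)).symm.tsum_eq, ENNReal.tsum_prod', ENNReal.tsum_comm]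
  rfl

lemma pH_swap {p : ℝ} (hp : 2 < p) {D D' U : Finset Site} (hU : U ⊆ D) (hU' : U ⊆ D')
    {ξ ξ' : {x // x ∈ U} → ℤ} {ζ ζ' : {x // ¬ x ∈ U} → ℤ}
    (h : Supp D (glue U (ξ, ζ))) (h' : Supp D' (glue U (ξ', ζ')))
    (hb : ∀ e ∈ bd U, glue U (ξ, ζ) (out U e) ≤ glue U (ξ', ζ') (out U e)) :
    Supp D (glue U (ξ ⊓ ξ', ζ)) ∧ Supp D' (glue U (ξ ⊔ ξ', ζ')) ∧
    pH p (glue U (ξ ⊓ ξ', ζ)) + pH p (glue U (ξ ⊔ ξ', ζ')) ≤ pH p (glue U (ξ, ζ)) + pH p (glue U (ξ', ζ')) := by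
  have hin : ∀ (ξ : {x // x ∈ U} → ℤ) (ζ : {x // ¬ x ∈ U} → ℤ) (x : Site) (hx : x ∈ U), glue U (ξ, ζ) x = ξ ⟨x, hx⟩ := by
    intro ξ ζ x hx; simp [glue, hx]
  have hout : ∀ (ξ : {x // x ∈ U} → ℤ) (ζ : {x // ¬ x ∈ U} → ℤ) (x : Site) (hx : x ∉ U), glue U (ξ, ζ) x = ζ ⟨x, hx⟩ := by
    intro ξ ζ x hx; simp [glue, hx]
  have s1 : Supp D (glue U (ξ ⊓ ξ', ζ)) := by
    intro x hx
    have hx' : x ∉ U := fun k => hx (hU k)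
    rw [hout _ _ x hx', ← hout ξ ζ x hx']; exact h x hx
  have s2 : Supp D' (glue U (ξ ⊔ ξ', ζ')) := by
    intro x hx
    have hx' : x ∉ U := fun k => hx (hU' k)
    rw [hout _ _ x hx', ← hout ξ' ζ' x hx']; exact h' x hx
  refine ⟨s1, s2, ?_⟩
  have m1 : ∀ e, e.1 ∈ D ∨ tip e ∈ D → e ∈ Ed D ∪ Ed D' := fun e he => Finset.mem_union_left _ (mem_Ed he)
  have m2 : ∀ e, e.1 ∈ D' ∨ tip e ∈ D' → e ∈ Ed D ∪ Ed D' := fun e he => Finset.mem_union_right _ (mem_Ed he)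
  rw [pH_sum hp h _ m1, pH_sum hp h' _ m2, pH_sum hp s1 _ m1, pH_sum hp s2 _ m2, ← Finset.sum_add_distrib, ← Finset.sum_add_distrib]
  apply Finset.sum_le_sum
  intro e _
  by_cases k1 : e.1 ∈ U <;> by_cases k2 : tip e ∈ U
  · simp only [hin _ _ _ k1, hin _ _ _ k2, Pi.inf_apply, Pi.sup_apply]
    exact V_minmax hp _ _ _ _
  · have hm : e ∈ bd U := by rw [mem_bd]; tauto
    have := hb e hm
    unfold out at this
    simp only [if_pos k1] at this
    rw [hout _ _ _ k2, hout _ _ _ k2] at this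
    simp only [hin _ _ _ k1, hout _ _ _ k2, Pi.inf_apply, Pi.sup_apply]
    exact V_minmax' hp _ _ _ _ this
  · have hm : e ∈ bd U := by rw [mem_bd]; tauto
    have := hb e hm
    unfold out at this
    simp only [if_neg k1] at this
    rw [hout _ _ _ k1, hout _ _ _ k1] at this
    simp only [hin _ _ _ k2, hout _ _ _ k1, Pi.inf_apply, Pi.sup_apply]
    have q := V_minmax' hp (ξ ⟨_, k2⟩) (ζ ⟨_, k1⟩) (ξ' ⟨_, k2⟩) (ζ' ⟨_, k1⟩) this
    rw [← V_neg p (min _ _ - _), ← V_neg p (max _ _ - _), ← V_neg p (ξ _ - _), ← V_neg p (ξ' _ - _)] at q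
    simp only [neg_sub] at q
    exact q
  · simp only [hout _ _ _ k1, hout _ _ _ k2]
    exact le_rfl

lemma tsum_mul_le {α β : Type*} (F F' : α → ℝ≥0∞) (G G' : β → ℝ≥0∞) (h : ∀ a b, F a * G b ≤ F' a * G' b) :
    (∑' a, F a) * (∑' b, G b) ≤ (∑' a, F' a) * (∑' b, G' b) := by
  rw [← ENNReal.tsum_mul_right, ← ENNReal.tsum_mul_right]
  apply ENNReal.tsum_le_tsum
  intro a
  rw [← ENNReal.tsum_mul_left, ← ENNReal.tsum_mul_left]
  exact ENNReal.tsum_le_tsum (h a)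

lemma W_swap {p β : ℝ} (hp : 2 < p) (hβ : 0 ≤ β) {D D' U : Finset Site} (hU : U ⊆ D) (hU' : U ⊆ D')
    {x : Site} (hx : x ∈ U) (h : ℤ) :
    W p β D (fun η => h ≤ η x ∧ ∀ e ∈ bd U, η (out U e) ≤ 0) * W p β D' (fun η => ∀ e ∈ bd U, 0 ≤ η (out U e))
      ≤ W p β D (fun _ => True) * W p β D' (fun η => h ≤ η x) := by
  rw [W_glue p β D _ U, W_glue p β D' _ U, W_glue p β D _ U, W_glue p β D' _ U]
  apply tsum_mul_le
  intro ζ ζ'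
  apply four_tsum
  intro ξ ξ'
  by_cases c1 : Supp D (glue U (ξ, ζ)) ∧ (h ≤ (glue U (ξ, ζ)) x ∧ ∀ e ∈ bd U, (glue U (ξ, ζ)) (out U e) ≤ 0)
  · by_cases c2 : Supp D' (glue U (ξ', ζ')) ∧ ∀ e ∈ bd U, 0 ≤ (glue U (ξ', ζ')) (out U e)
    · have hb : ∀ e ∈ bd U, glue U (ξ, ζ) (out U e) ≤ glue U (ξ', ζ') (out U e) := fun e he => (c1.2.2 e he).trans (c2.2 e he)
      obtain ⟨s1, s2, s3⟩ := pH_swap hp hU hU' c1.1 c2.1 hb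
      have c4 : h ≤ glue U (ξ ⊔ ξ', ζ') x := by
        have := c1.2.1
        simp only [glue, hx, dif_pos, Pi.sup_apply] at this ⊢
        exact le_trans this le_sup_left
      rw [if_pos c1, if_pos c2, if_pos ⟨s1, trivial⟩, if_pos ⟨s2, c4⟩]
      exact wtN_mul hβ s3
    · rw [if_neg c2]; simp
  · rw [if_neg c1]; simp

lemma pH_neg (p : ℝ) (η : Site → ℤ) : pH p (fun x => - η x) = pH p η := by
  unfold pH
  congr 1
  apply tsum_congr
  intro q
  rw [show - η q.1 - - η q.2 = -(η q.1 - η q.2) by ring, abs_neg]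

lemma W_neg (p β : ℝ) (D : Finset Site) (A : (Site → ℤ) → Prop) :
    W p β D (fun η => A (fun x => - η x)) = W p β D A := by
  unfold W
  rw [← (Equiv.neg (Site → ℤ)).tsum_eq (fun η => if Supp D η ∧ A η then wt p β η else 0)]
  apply tsum_congr
  intro η
  have e : (Equiv.neg (Site → ℤ)) η = fun x => - η x := rfl
  rw [e]
  have h1 : Supp D (fun x => - η x) ↔ Supp D η := by
    unfold Supp; simp
  simp only [h1, wt, pH_neg]

lemma pH_tr (p : ℝ) (z : Site) (η : Site → ℤ) : pH p (fun x => η (x + z)) = pH p η := by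
  unfold pH
  congr 1
  rw [← ((Equiv.addRight z).prodCongr (Equiv.addRight z)).tsum_eq (fun pr : Site × Site => if adjP pr.1 pr.2 then ((|η pr.1 - η pr.2| : ℤ) : ℝ) ^ p else 0)]
  apply tsum_congr
  intro q
  simp [adjP]

lemma W_tr (p β : ℝ) (D : Finset Site) (z : Site) (A : (Site → ℤ) → Prop) :
    W p β (D.image (fun x => x + z)) A = W p β D (fun η => A (fun x => η (x - z))) := by
  unfold W
  rw [← (Equiv.arrowCongr (Equiv.addRight z) (Equiv.refl ℤ)).tsum_eq]
  apply tsum_congr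
  intro η
  have e : (Equiv.arrowCongr (Equiv.addRight z) (Equiv.refl ℤ)) η = fun x => η (x - z) := by
    funext x; simp [Equiv.arrowCongr, sub_eq_add_neg]
  rw [e]
  have h1 : Supp (D.image (fun x => x + z)) (fun x => η (x - z)) ↔ Supp D η := by
    unfold Supp
    constructor
    · intro h x hx
      have := h (x + z) (by simpa using hx)
      simpa using this
    · intro h x hx
      apply h
      intro k
      apply hx
      rw [Finset.mem_image]
      exact ⟨_, k, by simp⟩
  have h2 : wt p β (fun x => η (x - z)) = wt p β η := by
    unfold wt
    have := pH_tr p (-z) η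
    simp only [← sub_eq_add_neg] at this
    rw [this]
  rw [h1, h2]

lemma W_half (p β : ℝ) (D : Finset Site) (x : Site) :
    W p β D (fun _ => True) ≤ 2 * W p β D (fun η => 0 ≤ η x) := by
  rw [two_mul]
  nth_rw 2 [← W_neg]
  apply W_le_add
  intro η _ _
  simp only
  omega

lemma W_fkg {p β : ℝ} (hp : 2 < p) (hβ : 0 ≤ β) (D : Finset Site) (hW : W p β D (fun _ => True) ≠ ⊤) (S : Finset Site) :
    W p β D (fun _ => True) ≤ 2 ^ S.card * W p β D (fun η => ∀ x ∈ S, 0 ≤ η x) := by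
  induction S using Finset.induction_on with
  | empty => simp
  | insert s S hs ih =>
    rw [Finset.card_insert_of_notMem hs]
    have h1 := W_shift hp hβ (D := D) (X := fun η => ∀ x ∈ S, 0 ≤ η x) (Y := fun η => 0 ≤ η s) (Z := fun _ => True)
      (Z' := fun η => ∀ x ∈ insert s S, 0 ≤ η x) 0 le_rfl ?_
    · have h2 := W_half p β D s
      set w := W p β D (fun _ => True)
      have hw0 : w ≠ 0 := W_zero_pos D trivial
      have : w * w ≤ w * (2 ^ (S.card + 1) * W p β D (fun η => ∀ x ∈ insert s S, 0 ≤ η x)) := by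
        calc w * w ≤ (2 ^ S.card * W p β D (fun η => ∀ x ∈ S, 0 ≤ η x)) * (2 * W p β D (fun η => 0 ≤ η s)) := mul_le_mul' ih h2
          _ = (2 ^ (S.card + 1)) * (W p β D (fun η => ∀ x ∈ S, 0 ≤ η x) * W p β D (fun η => 0 ≤ η s)) := by ring
          _ ≤ (2 ^ (S.card + 1)) * (w * W p β D (fun η => ∀ x ∈ insert s S, 0 ≤ η x)) := by gcongr
          _ = _ := by ring
      exact (ENNReal.mul_le_mul_iff_right hw0 hW).1 this
    · intro η η' a b
      refine ⟨trivial, fun x hx => ?_⟩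
      rw [Finset.mem_insert] at hx
      simp only [sub_zero]
      rcases hx with rfl | hx
      · exact le_trans b (le_max_right _ _)
      · exact le_trans (a x hx) (le_max_left _ _)

lemma absorb {X Y r : ℝ≥0∞} (h : X ≤ Y + r * X) (hr : r ≤ 1 / 2) (hX : X ≠ ⊤) : X ≤ 2 * Y := by
  have h1 : X ≤ Y + X / 2 := h.trans (by
    gcongr
    calc r * X ≤ (1 / 2) * X := by gcongr
      _ = X / 2 := by rw [ENNReal.div_eq_inv_mul, ENNReal.div_eq_inv_mul]; simp)
  have h2 : X / 2 + X / 2 ≤ Y + X / 2 := by rwa [ENNReal.add_halves]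
  have h3 : X / 2 ≤ Y := (ENNReal.add_le_add_iff_right (ENNReal.div_ne_top hX (by norm_num))).1 h2
  calc X = X / 2 + X / 2 := (ENNReal.add_halves X).symm
    _ ≤ Y + Y := add_le_add h3 h3
    _ = 2 * Y := (two_mul _).symm
end

section
open ENNReal NNReal

def RC (D : Finset Site) : Prop := ∀ a b c j : ℤ, a ≤ b → b ≤ c → (a, j) ∈ D → (c, j) ∈ D → (b, j) ∈ D

lemma ctr_level {D : Finset Site} (hD : RC D) {η : Site → ℤ} (hs : Supp D η) {k : ℤ} (hk : 1 ≤ k) {x : Site} (hx : k ≤ η x) :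
    ∃ C ⊆ D, Ctr x C ∧ ∀ e ∈ bd C, k ≤ η (inn C e) ∧ η (out C e) < k := by
  have hin : ∀ y, k ≤ η y → y ∈ D := by
    intro y hy
    by_contra c
    rw [hs y c] at hy; omega
  obtain ⟨C, hC, hb⟩ := exists_ctr (D.filter (fun y => k ≤ η y)) x (by simp [hin x hx, hx])
  have hb' : ∀ e ∈ bd C, k ≤ η (inn C e) ∧ η (out C e) < k := by
    intro e he
    obtain ⟨h1, h2⟩ := hb e he
    rw [Finset.mem_filter] at h1 h2
    refine ⟨h1.2, ?_⟩
    by_contra c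
    push Not at c
    exact h2 ⟨hin _ c, c⟩
  refine ⟨C, ?_, hC, hb'⟩
  rintro ⟨i, j⟩ hy
  obtain ⟨a, ha1, ha2, ha3⟩ := right_exit hy
  obtain ⟨b, hb1, hb2, hb3⟩ := left_exit hy
  have r1 := (hb' _ ha3).1
  have r2 := (hb' _ hb3).1
  simp only at ha1 ha2 hb1 hb2 ha3 hb3 r1 r2
  have nb : (b, j) ∉ C := by
    rw [mem_bd] at hb3
    intro k
    apply hb3
    simp [tip, k, hb2]
  rw [show inn C ((a, j), true) = (a, j) by simp [inn, ha2]] at r1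
  rw [show inn C ((b, j), true) = (b + 1, j) by simp [inn, nb, tip]] at r2
  exact hD (b + 1) i a j (by omega) ha1 (hin _ r2) (hin _ r1)

lemma flx_level {p : ℝ} (hp : 2 < p) {C : Finset Site} {η : Site → ℤ} {k : ℤ}
    (h : ∀ e ∈ bd C, k ≤ η (inn C e) ∧ η (out C e) < k) : ((bd C).card : ℝ) ≤ Flx p C η := by
  unfold Flx
  rw [Finset.card_eq_sum_ones]
  push_cast
  apply Finset.sum_le_sum
  intro e he
  apply dV_ge_one hp
  have := h e he
  omega

lemma peierls {p β δ : ℝ} (hβ : 0 < β) {D D' : Finset Site} {A B : (Site → ℤ) → Prop} (x : Site)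
    (T : Finset Site → (Site → ℤ) → (Site → ℤ)) (hT : ∀ i, Function.Injective (T i))
    (h : ∀ η, Supp D η → A η → ∃ C, Ctr x C ∧ Supp D' (T C η) ∧ B (T C η) ∧ pH p (T C η) + (δ + b0 / β * (bd C).card) ≤ pH p η) :
    W p β D A ≤ ENNReal.ofReal (Real.exp (-β * δ)) * W p β D' B := by
  refine (W_peierls hβ.le (Ctr x) _ T hT h).trans ?_
  gcongr
  calc _ = ∑' C : Finset Site, ENNReal.ofReal (Real.exp (-β * δ)) * (if Ctr x C then ENNReal.ofReal (Real.exp (-b0 * (bd C).card)) else 0) := by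
        apply tsum_congr
        intro C
        split_ifs
        · rw [← ENNReal.ofReal_mul (Real.exp_nonneg _), ← Real.exp_add]
          congr 2
          field_simp
          ring
        · simp
    _ ≤ _ := by
        rw [ENNReal.tsum_mul_left]
        exact mul_le_of_le_one_right zero_le (ctr_sum x)

lemma peierls_flx {p β m : ℝ} (hp : 2 < p) (hβ : b0 ≤ β) {D : Finset Site} {A B : (Site → ℤ) → Prop} (x : Site)
    (h : ∀ η, Supp D η → A η → ∃ C ⊆ D, Ctr x C ∧ ((bd C).card : ℝ) ≤ Flx p C η ∧ m ≤ Flx p C η ∧ B (low C η)) :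
    W p β D A ≤ ENNReal.ofReal (Real.exp (-(β - b0) * m)) * W p β D B := by
  have hb : 0 < β := b0_pos.trans_le hβ
  have := peierls (p := p) (δ := (1 - b0 / β) * m) hb (D := D) (D' := D) (A := A) (B := B) x low low_inj ?_
  · rw [show -β * ((1 - b0 / β) * m) = -(β - b0) * m by field_simp] at this
    exact this
  · intro η hs hA
    obtain ⟨C, hC, h1, h2, h3, h4⟩ := h η hs hA
    refine ⟨C, h1, supp_low hC hs, h4, ?_⟩
    rw [pH_low hp hC hs]
    have e1 : 0 ≤ 1 - b0 / β := by
      rw [sub_nonneg, div_le_one hb]; exact hβ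
    have e2 : 0 ≤ b0 / β := div_nonneg b0_pos.le hb.le
    nlinarith

def qq (β : ℝ) : ℝ≥0∞ := ENNReal.ofReal (Real.exp (-(β - b0)))

lemma W_step {p β : ℝ} (hp : 2 < p) (hβ : b0 ≤ β) {D : Finset Site} (hD : RC D) (x : Site) (k : ℤ) (hk : 1 ≤ k) :
    W p β D (fun η => η x = k) ≤ qq β * W p β D (fun η => η x = k - 1) := by
  have := peierls_flx (m := 1) hp hβ (D := D) (A := fun η => η x = k) (B := fun η => η x = k - 1) x ?_
  · rw [mul_one] at this; exact this
  · intro η hs hA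
    obtain ⟨C, hC, h1, h2⟩ := ctr_level hD hs hk hA.ge
    have := flx_level hp h2
    refine ⟨C, hC, h1, this, le_trans ?_ this, ?_⟩
    · exact_mod_cast bd_pos h1.1
    · simp [low, h1.1, hA]

lemma W_step_ge {p β : ℝ} (hp : 2 < p) (hβ : b0 ≤ β) {D : Finset Site} (hD : RC D) (x : Site) (k : ℤ) (hk : 1 ≤ k) :
    W p β D (fun η => k ≤ η x) ≤ qq β * W p β D (fun η => k - 1 ≤ η x) := by
  have := peierls_flx (m := 1) hp hβ (D := D) (A := fun η => k ≤ η x) (B := fun η => k - 1 ≤ η x) x ?_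
  · rw [mul_one] at this; exact this
  · intro η hs hA
    obtain ⟨C, hC, h1, h2⟩ := ctr_level hD hs hk hA
    have := flx_level hp h2
    refine ⟨C, hC, h1, this, le_trans ?_ this, ?_⟩
    · exact_mod_cast bd_pos h1.1
    · simp [low, h1.1]; omega

lemma W_pow {p β : ℝ} (hp : 2 < p) (hβ : b0 ≤ β) {D : Finset Site} (hD : RC D) (x : Site) (n : ℕ) :
    W p β D (fun η => η x = n) ≤ qq β ^ n * W p β D (fun _ => True) := by
  induction n with
  | zero => simpa using W_mono fun _ _ _ => trivial
  | succ n ih =>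
    refine (W_step hp hβ hD x _ (by omega)).trans ?_
    rw [pow_succ', mul_assoc]
    gcongr
    simpa using ih

lemma W_pow_neg {p β : ℝ} (hp : 2 < p) (hβ : b0 ≤ β) {D : Finset Site} (hD : RC D) (x : Site) (n : ℕ) :
    W p β D (fun η => η x = -(n : ℤ)) ≤ qq β ^ n * W p β D (fun _ => True) := by
  refine le_trans (le_of_eq ?_) (W_pow hp hβ hD x n)
  rw [← W_neg]
  apply W_congr
  intro η _
  simp

lemma W_ge_one {p β : ℝ} (hp : 2 < p) (hβ : b0 ≤ β) {D : Finset Site} (hD : RC D) (x : Site) :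
    W p β D (fun η => 1 ≤ η x) ≤ qq β * W p β D (fun _ => True) := by
  refine (W_step_ge hp hβ hD x 1 le_rfl).trans ?_
  gcongr
  exact W_mono fun _ _ _ => trivial

lemma W_le_neg_one {p β : ℝ} (hp : 2 < p) (hβ : b0 ≤ β) {D : Finset Site} (hD : RC D) (x : Site) :
    W p β D (fun η => η x ≤ -1) ≤ qq β * W p β D (fun _ => True) := by
  refine le_trans (le_of_eq ?_) (W_ge_one hp hβ hD x)
  rw [← W_neg]
  apply W_congr
  intro η _
  show -η x ≤ -1 ↔ 1 ≤ η x
  omega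

lemma W_ne_zero {p β : ℝ} (hp : 2 < p) (hβ : b0 ≤ β) {D : Finset Site} (hD : RC D) (x : Site) :
    W p β D (fun η => η x ≠ 0) ≤ 2 * qq β * W p β D (fun _ => True) := by
  rw [mul_assoc, two_mul]
  refine (W_le_add _ (fun η => 1 ≤ η x) (fun η => η x ≤ -1) ?_).trans (add_le_add (W_ge_one hp hβ hD x) (W_le_neg_one hp hβ hD x))
  intro η _ h
  omega

lemma W_fin {p β : ℝ} {D : Finset Site} (hW : W p β D (fun _ => True) ≠ ⊤) (A : (Site → ℤ) → Prop) : W p β D A ≠ ⊤ :=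
  ne_top_of_le_ne_top hW (W_mono fun _ _ _ => trivial)

lemma W_ge_eq {p β : ℝ} (hp : 2 < p) (hβ : b0 ≤ β) (hq : qq β ≤ 1 / 2) {D : Finset Site} (hD : RC D)
    (hW : W p β D (fun _ => True) ≠ ⊤) (x : Site) (h : ℤ) (hh : 0 ≤ h) :
    W p β D (fun η => h ≤ η x) ≤ 2 * W p β D (fun η => η x = h) := by
  refine absorb (r := qq β) ?_ hq (W_fin hW _)
  refine (W_le_add _ (fun η => η x = h) (fun η => h + 1 ≤ η x) (fun η _ k => by omega)).trans ?_
  gcongr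
  have := W_step_ge hp hβ hD x (h + 1) (by omega)
  simpa using this

lemma W_logconc {p β : ℝ} (hp : 2 < p) (hβ : 0 ≤ β) (D : Finset Site) (x : Site) (n : ℤ) :
    W p β D (fun η => η x = n + 1) * W p β D (fun η => η x = n - 1) ≤ W p β D (fun η => η x = n) * W p β D (fun η => η x = n) := by
  apply W_shift hp hβ 1 (by norm_num)
  intro η η' h1 h2
  simp [h1, h2]

lemma W_nb_one {p β : ℝ} (hp : 2 < p) (hβ : b0 ≤ β) (hq : qq β ≤ 1 / 16) {D : Finset Site} (hD : RC D)
    (hW : W p β D (fun _ => True) ≠ ⊤) (x z y : Site) (h : ℤ) (hh : 0 ≤ h) :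
    W p β D (fun η => (η z = h ∧ η x = h) ∧ h + 1 ≤ η y) ≤ (2 * qq β) * W p β D (fun η => η z = h ∧ η x = h) := by
  have hb : 0 ≤ β := b0_pos.le.trans hβ
  have h1 := W_shift hp hb (D := D) (X := fun η => (η z = h ∧ η x = h) ∧ h + 1 ≤ η y) (Y := fun η => η z = 0 ∧ η x = 0)
    (Z := fun η => η z = h ∧ η x = h) (Z' := fun η => 1 ≤ η y) h hh ?_
  · have h2 := W_ge_one hp hβ hD y
    set w := W p β D (fun _ => True) with hw
    have hw0 : w ≠ 0 := W_zero_pos D trivial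
    have h3 : w ≤ 2 * W p β D (fun η => η z = 0 ∧ η x = 0) := by
      refine absorb (r := 4 * qq β) ?_ ?_ hW
      · refine (W_le_add _ (fun η => η z = 0 ∧ η x = 0) (fun η => η z ≠ 0 ∨ η x ≠ 0) (fun η _ _ => by tauto)).trans ?_
        gcongr
        refine (W_le_add _ (fun η => η z ≠ 0) (fun η => η x ≠ 0) (fun η _ k => k)).trans ?_
        refine (add_le_add (W_ne_zero hp hβ hD z) (W_ne_zero hp hβ hD x)).trans (le_of_eq ?_)
        ring
      · calc 4 * qq β ≤ 4 * (1 / 16) := by gcongr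
          _ ≤ 1 / 2 := by
            rw [← ENNReal.toReal_le_toReal (by finiteness) (by finiteness)]; norm_num
    have : w * W p β D (fun η => (η z = h ∧ η x = h) ∧ h + 1 ≤ η y) ≤ w * ((2 * qq β) * W p β D (fun η => η z = h ∧ η x = h)) := by
      calc _ ≤ (2 * W p β D (fun η => η z = 0 ∧ η x = 0)) * W p β D (fun η => (η z = h ∧ η x = h) ∧ h + 1 ≤ η y) := by gcongr
        _ = 2 * (W p β D (fun η => (η z = h ∧ η x = h) ∧ h + 1 ≤ η y) * W p β D (fun η => η z = 0 ∧ η x = 0)) := by ring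
        _ ≤ 2 * (W p β D (fun η => η z = h ∧ η x = h) * W p β D (fun η => 1 ≤ η y)) := by gcongr
        _ ≤ 2 * (W p β D (fun η => η z = h ∧ η x = h) * (qq β * w)) := by gcongr
        _ = _ := by ring
    exact (ENNReal.mul_le_mul_iff_right hw0 hW).1 this
  · intro η η' a b
    refine ⟨⟨?_, ?_⟩, ?_⟩
    · simp [a.1.1, b.1]
    · simp [a.1.2, b.2]
    · exact le_trans (by have := a.2; omega) (le_max_left _ _)

lemma W_nb {p β : ℝ} (hp : 2 < p) (hβ : b0 ≤ β) (hq : qq β ≤ 1 / 16) {D : Finset Site} (hD : RC D)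
    (hW : W p β D (fun _ => True) ≠ ⊤) (x z : Site) (h : ℤ) (hh : 0 ≤ h) (S : Finset Site) (hS : S.card ≤ 4) :
    W p β D (fun η => η z = h ∧ η x = h) ≤ 2 * W p β D (fun η => (η z = h ∧ η x = h) ∧ ∀ y ∈ S, η y ≤ h) := by
  have key : W p β D (fun η => η z = h ∧ η x = h) ≤ W p β D (fun η => (η z = h ∧ η x = h) ∧ ∀ y ∈ S, η y ≤ h) +
      (S.card * (2 * qq β)) * W p β D (fun η => η z = h ∧ η x = h) := by
    clear hS
    induction S using Finset.induction_on with
    | empty => simp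
    | insert s S hs ih =>
      rw [Finset.card_insert_of_notMem hs]
      refine ih.trans ?_
      have h1 := W_le_add (p := p) (β := β) (D := D) (fun η => (η z = h ∧ η x = h) ∧ ∀ y ∈ S, η y ≤ h)
        (fun η => (η z = h ∧ η x = h) ∧ ∀ y ∈ insert s S, η y ≤ h) (fun η => (η z = h ∧ η x = h) ∧ h + 1 ≤ η s) ?_
      · refine (add_le_add_left (h1.trans (add_le_add_right (W_nb_one hp hβ hq hD hW x z s h hh) _)) _).trans (le_of_eq ?_)
        push_cast
        ring
      · intro η _ a
        by_cases c : η s ≤ h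
        · left
          refine ⟨a.1, ?_⟩
          intro y hy
          rw [Finset.mem_insert] at hy
          rcases hy with rfl | hy
          · exact c
          · exact a.2 y hy
        · right
          exact ⟨a.1, by omega⟩
  refine absorb key ?_ (W_fin hW _)
  calc (S.card : ℝ≥0∞) * (2 * qq β) ≤ 4 * (2 * (1 / 16)) := by
        gcongr
        exact_mod_cast hS
    _ ≤ 1 / 2 := by
        rw [← ENNReal.toReal_le_toReal (by finiteness) (by finiteness)]; norm_num
end

section
open ENNReal NNReal

def mom (p : ℝ) : ℝ≥0∞ := ∑' k : ℤ, ENNReal.ofReal (V p k) * (1 / 16) ^ k.natAbs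

lemma mom_fin {p : ℝ} (hp : 2 < p) : mom p ≠ ⊤ := by
  have hs : Summable (fun k : ℤ => V p k * (1 / 16 : ℝ) ^ k.natAbs) := by
    have h1 : Summable (fun n : ℕ => V p n * (1 / 16 : ℝ) ^ n) := by
      refine Summable.of_nonneg_of_le (fun n => by have := V_nonneg p n; positivity) (fun n => ?_)
        (summable_pow_mul_geometric_of_norm_lt_one (R := ℝ) ⌈p⌉₊ (r := 1 / 16) (by norm_num))
      gcongr
      unfold V
      rcases Nat.eq_zero_or_pos n with rfl | hn
      · simp
        rw [Real.zero_rpow (by linarith)]; positivity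
      · rw [show (((|((n:ℕ):ℤ)| : ℤ)) : ℝ) = (n : ℝ) by simp, ← Real.rpow_natCast]
        exact Real.rpow_le_rpow_of_exponent_le (by exact_mod_cast hn) (Nat.le_ceil p)
    apply Summable.of_nat_of_neg
    · simpa using h1
    · simpa [V_neg] using h1
  have e : mom p = ∑' k : ℤ, ENNReal.ofReal (V p k * (1 / 16 : ℝ) ^ k.natAbs) := by
    unfold mom
    apply tsum_congr
    intro k
    rw [ENNReal.ofReal_mul (V_nonneg p k), ENNReal.ofReal_pow (by norm_num)]
    congr 2
    rw [ENNReal.ofReal_div_of_pos (by norm_num)]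
    simp
  rw [e]
  exact hs.tsum_ofReal_ne_top

lemma EV_le {p β : ℝ} (hp : 2 < p) (hβ : b0 ≤ β) (hq : qq β ≤ 1 / 16) {D : Finset Site} (hD : RC D) (y : Site) :
    ∑' η : Site → ℤ, (if Supp D η then ENNReal.ofReal (V p (η y)) * wt p β η else 0) ≤ mom p * W p β D (fun _ => True) := by
  calc _ ≤ ∑' η : Site → ℤ, ∑' k : ℤ, ENNReal.ofReal (V p k) * (if Supp D η ∧ η y = k then wt p β η else 0) := by
        apply ENNReal.tsum_le_tsum
        intro η
        refine le_trans ?_ (ENNReal.le_tsum (η y))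
        by_cases h : Supp D η <;> simp [h]
    _ = ∑' k : ℤ, ENNReal.ofReal (V p k) * W p β D (fun η => η y = k) := by
        rw [ENNReal.tsum_comm]
        apply tsum_congr
        intro k
        rw [ENNReal.tsum_mul_left]
        unfold W
        congr 1
        apply tsum_congr
        intro η
        congr
    _ ≤ ∑' k : ℤ, (ENNReal.ofReal (V p k) * (1 / 16) ^ k.natAbs) * W p β D (fun _ => True) := by
        apply ENNReal.tsum_le_tsum
        intro k
        rw [mul_assoc]
        gcongr
        have : W p β D (fun η => η y = k) ≤ qq β ^ k.natAbs * W p β D (fun _ => True) := by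
          rcases Int.natAbs_eq k with h | h
          · have := W_pow hp hβ hD y k.natAbs
            rwa [← h] at this
          · have := W_pow_neg hp hβ hD y k.natAbs
            rwa [← h] at this
        refine this.trans ?_
        gcongr
    _ = _ := by rw [ENNReal.tsum_mul_right]; rfl

def box (x : Site) (n : ℕ) : Finset Site := Finset.Icc (x.1 - n) (x.1 + n) ×ˢ Finset.Icc (x.2 - n) (x.2 + n)
lemma mem_box {x y : Site} {n : ℕ} : y ∈ box x n ↔ (x.1 - n ≤ y.1 ∧ y.1 ≤ x.1 + n) ∧ (x.2 - n ≤ y.2 ∧ y.2 ≤ x.2 + n) := by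
  unfold box
  rw [Finset.mem_product, Finset.mem_Icc, Finset.mem_Icc]
lemma card_box (x : Site) (n : ℕ) : (box x n).card = (2 * n + 1) ^ 2 := by
  unfold box
  rw [Finset.card_product, Int.card_Icc, Int.card_Icc, sq]
  congr 1 <;> omega

def SV (p : ℝ) (x : Site) (n : ℕ) (η : Site → ℤ) : ℝ :=
  ∑ e ∈ (box x n) ×ˢ (Finset.univ : Finset Bool), (V p (η e.1) + V p (η (tip e)))

lemma markov {p β : ℝ} (hp : 2 < p) (hβ : b0 ≤ β) (hq : qq β ≤ 1 / 16) {D : Finset Site} (hD : RC D) (x : Site) (n : ℕ)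
    (N : ℝ) :
    ENNReal.ofReal N * W p β D (fun η => N < SV p x n η) ≤ (4 * (2 * n + 1) ^ 2) * (mom p * W p β D (fun _ => True)) := by
  calc _ ≤ ∑' η : Site → ℤ, ∑ e ∈ (box x n) ×ˢ (Finset.univ : Finset Bool),
          ((if Supp D η then ENNReal.ofReal (V p (η e.1)) * wt p β η else 0) + (if Supp D η then ENNReal.ofReal (V p (η (tip e))) * wt p β η else 0)) := by
        unfold W
        rw [← ENNReal.tsum_mul_left]
        apply ENNReal.tsum_le_tsum
        intro η
        by_cases h : Supp D η ∧ N < SV p x n η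
        · rw [if_pos h]
          simp only [if_pos h.1]
          simp only [← add_mul]
          rw [← Finset.sum_mul]
          gcongr
          refine (ENNReal.ofReal_le_ofReal h.2.le).trans ?_
          unfold SV
          rw [ENNReal.ofReal_sum_of_nonneg (fun e _ => add_nonneg (V_nonneg _ _) (V_nonneg _ _))]
          exact Finset.sum_le_sum fun e _ => ENNReal.ofReal_add_le
        · rw [if_neg h]; simp
    _ = ∑ e ∈ (box x n) ×ˢ (Finset.univ : Finset Bool), ((∑' η : Site → ℤ, (if Supp D η then ENNReal.ofReal (V p (η e.1)) * wt p β η else 0)) +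
          ∑' η : Site → ℤ, (if Supp D η then ENNReal.ofReal (V p (η (tip e))) * wt p β η else 0)) := by
        rw [Summable.tsum_finsetSum (fun _ _ => ENNReal.summable)]
        simp only [ENNReal.tsum_add]
    _ ≤ ∑ e ∈ (box x n) ×ˢ (Finset.univ : Finset Bool), (mom p * W p β D (fun _ => True) + mom p * W p β D (fun _ => True)) := by
        apply Finset.sum_le_sum
        intro e _
        exact add_le_add (EV_le hp hβ hq hD _) (EV_le hp hβ hq hD _)
    _ = _ := by
        rw [Finset.sum_const, Finset.card_product, card_box]
        simp only [Finset.card_univ, Fintype.card_bool, nsmul_eq_mul]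
        push_cast
        ring

def cone (x : Site) (n : ℕ) (y : Site) : ℤ := max 0 (n - max |y.1 - x.1| |y.2 - x.2|)

lemma cone_edge (x : Site) (n : ℕ) (e : Edge) : |cone x n e.1 - cone x n (tip e)| ≤ 1 ∧
    (cone x n e.1 ≠ cone x n (tip e) → e.1 ∈ box x n) := by
  obtain ⟨⟨a, b⟩, c⟩ := e
  obtain ⟨u, v⟩ := x
  have : ∀ t : ℤ, |t + 1| ≤ |t| + 1 ∧ |t| ≤ |t + 1| + 1 := by
    intro t
    rcases abs_cases t with h | h <;> rcases abs_cases (t + 1) with h' | h' <;> omega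
  have h1 := this (a - u)
  have h2 := this (b - v)
  rw [mem_box]
  cases c
  · simp only [cone, tip, Bool.false_eq_true, if_false]
    rw [show b + 1 - v = b - v + 1 by ring, abs_le]
    rcases abs_cases (a - u) with h | h <;> rcases abs_cases (b - v) with h' | h' <;> omega
  · simp only [cone, tip, if_true]
    rw [show a + 1 - u = a - u + 1 by ring, abs_le]
    rcases abs_cases (a - u) with h | h <;> rcases abs_cases (b - v) with h' | h' <;> omega

lemma cone_supp (x : Site) (n : ℕ) (y : Site) (h : y ∉ box x n) : cone x n y = 0 := by
  rw [mem_box] at h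
  unfold cone
  rcases abs_cases (y.1 - x.1) with k | k <;> rcases abs_cases (y.2 - x.2) with k' | k' <;> omega

lemma V_add_le {p : ℝ} (hp : 2 < p) (a b : ℤ) : V p (a + b) ≤ 2 ^ p * (V p a + V p b) := by
  have h2 : (0 : ℝ) ≤ 2 ^ p := by positivity
  have key : ∀ a b : ℤ, |a| ≤ |b| → V p (a + b) ≤ 2 ^ p * V p b := by
    intro a b h
    unfold V
    rw [← Real.mul_rpow (by norm_num) (by positivity)]
    apply Real.rpow_le_rpow (by positivity) _ (by linarith)
    have : |a + b| ≤ 2 * |b| := (abs_add_le a b).trans (by linarith)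
    exact_mod_cast this
  have ha := V_nonneg p a
  have hb := V_nonneg p b
  rcases le_total |a| |b| with h | h
  · have := key a b h
    nlinarith
  · have := key b a h
    rw [add_comm] at this
    nlinarith

lemma cone_pH {p : ℝ} (hp : 2 < p) {D : Finset Site} {η : Site → ℤ} (hs : Supp D η) (x : Site) (n : ℕ) (hb : box x n ⊆ D) :
    pH p (fun y => η y + cone x n y) ≤ pH p η + (2 ^ p * 2 ^ p * SV p x n η + 2 ^ p * 2 * (2 * n + 1) ^ 2) := by
  have hs' : Supp D (fun y => η y + cone x n y) := by
    intro y hy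
    have := cone_supp x n y (fun k => hy (hb k))
    simp [hs y hy, this]
  have hE : ∀ e : Edge, e.1 ∈ D ∨ tip e ∈ D → e ∈ Ed D ∪ (box x n) ×ˢ (Finset.univ : Finset Bool) := fun e he => Finset.mem_union_left _ (mem_Ed he)
  rw [pH_sum hp hs' _ hE, pH_sum hp hs _ hE]
  have e1 : 2 ^ p * 2 ^ p * SV p x n η + 2 ^ p * 2 * (2 * n + 1) ^ 2 = ∑ e ∈ (box x n) ×ˢ (Finset.univ : Finset Bool), (2 ^ p * 2 ^ p * (V p (η e.1) + V p (η (tip e))) + 2 ^ p) := by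
    rw [Finset.sum_add_distrib, ← Finset.mul_sum, Finset.sum_const, Finset.card_product, card_box]
    simp only [Finset.card_univ, Fintype.card_bool, nsmul_eq_mul]
    unfold SV
    push_cast
    ring
  have e2 : ∑ e ∈ (box x n) ×ˢ (Finset.univ : Finset Bool), (2 ^ p * 2 ^ p * (V p (η e.1) + V p (η (tip e))) + 2 ^ p) =
      ∑ e ∈ Ed D ∪ (box x n) ×ˢ (Finset.univ : Finset Bool), (if e ∈ (box x n) ×ˢ (Finset.univ : Finset Bool) then (2 ^ p * 2 ^ p * (V p (η e.1) + V p (η (tip e))) + 2 ^ p) else 0) := by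
    rw [Finset.sum_ite_mem, Finset.inter_eq_right.2 Finset.subset_union_right]
  rw [e1, e2, ← Finset.sum_add_distrib]
  apply Finset.sum_le_sum
  intro e _
  have h2 : (0 : ℝ) ≤ 2 ^ p := by positivity
  obtain ⟨c1, c2⟩ := cone_edge x n e
  have v1 := V_nonneg p (η e.1)
  have v2 := V_nonneg p (η (tip e))
  by_cases c : cone x n e.1 = cone x n (tip e)
  · rw [c, show η e.1 + cone x n (tip e) - (η (tip e) + cone x n (tip e)) = η e.1 - η (tip e) by ring]
    split_ifs
    · have : 0 ≤ 2 ^ p * 2 ^ p * (V p (η e.1) + V p (η (tip e))) := by positivity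
      linarith
    · linarith
  · have m := c2 c
    rw [if_pos (by simp [m])]
    have a1 := V_add_le hp (η e.1 - η (tip e)) (cone x n e.1 - cone x n (tip e))
    have a2 := V_add_le hp (η e.1) (-η (tip e))
    rw [V_neg] at a2
    have a3 : V p (cone x n e.1 - cone x n (tip e)) ≤ 1 := by
      unfold V
      apply Real.rpow_le_one (by positivity) (by exact_mod_cast c1) (by linarith)
    have a4 := V_nonneg p (η e.1 - η (tip e))
    rw [show η e.1 + cone x n e.1 - (η (tip e) + cone x n (tip e)) = η e.1 - η (tip e) + (cone x n e.1 - cone x n (tip e)) by ring]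
    rw [← sub_eq_add_neg] at a2
    calc _ ≤ _ := a1
      _ ≤ 2 ^ p * (2 ^ p * (V p (η e.1) + V p (η (tip e))) + 1) := by gcongr
      _ ≤ _ := by linarith

lemma cone_lb {p : ℝ} (hp : 2 < p) : ∃ C > (0 : ℝ), ∀ β : ℝ, b0 ≤ β → qq β ≤ 1 / 16 → ∀ D : Finset Site, RC D →
    W p β D (fun _ => True) ≠ ⊤ → ∀ (x : Site) (n : ℕ), 1 ≤ n → box x n ⊆ D →
    W p β D (fun _ => True) ≤ ENNReal.ofReal (2 * Real.exp (β * (C * n ^ 2))) * W p β D (fun η => η x = n) := by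
  set m := (mom p).toReal + 1 with hm
  have hm0 : 0 < m := by positivity
  have hmle : mom p ≤ ENNReal.ofReal m := by
    rw [← ENNReal.ofReal_toReal (mom_fin hp)]
    apply ENNReal.ofReal_le_ofReal
    rw [hm]; linarith
  refine ⟨2 ^ p * 2 ^ p * (16 * m * 9) + 2 ^ p * 2 * 9, by positivity, ?_⟩
  intro β hβ hq D hD hW x n hn hb
  have hβ0 : 0 < β := b0_pos.trans_le hβ
  set w := W p β D (fun _ => True) with hw
  set N : ℝ := 16 * m * (2 * n + 1) ^ 2 with hN
  have hN0 : 0 < N := by positivity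
  have h1 := markov hp hβ hq hD x n N
  have h2 : W p β D (fun η => N < SV p x n η) ≤ (1 / 4) * w := by
    have : ENNReal.ofReal N * W p β D (fun η => N < SV p x n η) ≤ ENNReal.ofReal N * ((1 / 4) * w) := by
      refine h1.trans ?_
      calc _ ≤ (4 * (2 * n + 1) ^ 2) * (ENNReal.ofReal m * w) := by gcongr
        _ = ENNReal.ofReal N * (1 / 4) * w := by
          rw [← mul_assoc]
          congr 1
          rw [← ENNReal.toReal_eq_toReal_iff' (by finiteness) (by finiteness)]
          simp only [ENNReal.toReal_mul, ENNReal.toReal_ofReal hN0.le, ENNReal.toReal_ofReal hm0.le, ENNReal.toReal_pow]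
          rw [ENNReal.toReal_add (by finiteness) (by finiteness)]
          simp
          rw [hN]; ring
        _ = _ := by ring
    exact (ENNReal.mul_le_mul_iff_right (by simpa using hN0) (by finiteness)).1 this
  have h3 : w ≤ 2 * W p β D (fun η => η x = 0 ∧ SV p x n η ≤ N) := by
    refine absorb (r := 2 * qq β + 1 / 4) ?_ ?_ hW
    · refine (W_le_add _ (fun η => η x = 0 ∧ SV p x n η ≤ N) (fun η => η x ≠ 0 ∨ N < SV p x n η) (fun η _ _ => ?_)).trans ?_
      · by_cases c : SV p x n η ≤ N
        · tauto
        · right; right; exact not_le.1 c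
      gcongr
      refine (W_le_add _ (fun η => η x ≠ 0) (fun η => N < SV p x n η) (fun η _ k => k)).trans ?_
      rw [add_mul]
      exact add_le_add (W_ne_zero hp hβ hD x) h2
    · calc 2 * qq β + 1 / 4 ≤ 2 * (1 / 16) + 1 / 4 := by gcongr
        _ ≤ 1 / 2 := by
          rw [← ENNReal.toReal_le_toReal (by finiteness) (by finiteness), ENNReal.toReal_add (by finiteness) (by finiteness)]; norm_num
  have h4 := W_inj (p := p) (δ := -(2 ^ p * 2 ^ p * N + 2 ^ p * 2 * (2 * n + 1) ^ 2)) hβ0.le (D := D) (D' := D) (A := fun η => η x = 0 ∧ SV p x n η ≤ N) (B := fun η => η x = n)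
    (fun η y => η y + cone x n y) ?_ ?_
  · refine h3.trans ((mul_le_mul_right h4 _).trans ?_)
    rw [← mul_assoc]
    gcongr
    rw [ENNReal.ofReal_mul (by norm_num)]
    simp only [ENNReal.ofReal_ofNat]
    rw [neg_mul_neg]
    gcongr
    have hn' : (1 : ℝ) ≤ n := by exact_mod_cast hn
    have h9 : ((2 : ℝ) * n + 1) ^ 2 ≤ 9 * n ^ 2 := by nlinarith
    rw [hN]
    calc _ ≤ 2 ^ p * 2 ^ p * (16 * m * (9 * n ^ 2)) + 2 ^ p * 2 * ((9 : ℝ) * n ^ 2) := by gcongr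
      _ = _ := by ring
  · intro η η' h
    funext y
    have := congrFun h y
    simp only at this
    omega
  · intro η hs ⟨hA, hS⟩
    refine ⟨?_, ?_, ?_⟩
    · intro y hy
      have := cone_supp x n y (fun k => hy (hb k))
      simp [hs y hy, this]
    · simp [hA, cone]
    · have := cone_pH hp hs x n hb
      have h2 : (0 : ℝ) ≤ 2 ^ p * 2 ^ p := by positivity
      nlinarith [mul_le_mul_of_nonneg_left hS h2]
end

section
open ENNReal NNReal

lemma ratio {p : ℝ} (hp : 2 < p) : ∃ C > (0 : ℝ), ∀ β : ℝ, b0 ≤ β → qq β ≤ 1 / 16 → ∀ D : Finset Site, RC D →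
    W p β D (fun _ => True) ≠ ⊤ → ∀ (x : Site) (h : ℕ), 1 ≤ h → box x (2 * h) ⊆ D →
    W p β D (fun η => η x = (h : ℤ) - 1) ≤ ENNReal.ofReal (2 * Real.exp (β * (C * h))) * W p β D (fun η => η x = h) := by
  obtain ⟨C, hC, H⟩ := cone_lb hp
  refine ⟨4 * C, by positivity, ?_⟩
  intro β hβ hq D hD hW x h hh hb
  have hβ0 : 0 < β := b0_pos.trans_le hβ
  have h1 := H β hβ hq D hD hW x (2 * h) (by omega) hb
  set w := W p β D (fun _ => True) with hw
  set a : ℤ → ℝ := fun n => (W p β D (fun η => η x = n)).toReal with ha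
  have hfin : ∀ n : ℤ, W p β D (fun η => η x = n) ≠ ⊤ := fun n => W_fin hW _
  have hw0 : w ≠ 0 := W_zero_pos D trivial
  have hwr : 0 < w.toReal := ENNReal.toReal_pos hw0 hW
  have hmono : ∀ n : ℤ, a n ≤ w.toReal := fun n => ENNReal.toReal_mono hW (W_mono fun _ _ _ => trivial)
  have hA0 : ∀ n, 0 ≤ a n := fun n => ENNReal.toReal_nonneg
  have h2 : w.toReal ≤ (2 * Real.exp (β * (C * (2 * h) ^ 2))) * a (h + h) := by
    have := ENNReal.toReal_mono (by finiteness [hfin ((2 * h : ℕ) : ℤ)]) h1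
    rw [ENNReal.toReal_mul, ENNReal.toReal_ofReal (by positivity)] at this
    rw [ha]
    simp only
    rw [show ((h : ℤ) + h) = ((2 * h : ℕ) : ℤ) by push_cast; ring]
    convert this using 3
    push_cast
    ring
  have hsh : ∀ j : ℕ, a (h + (j + 1)) * a (h - 1) ≤ a (h + j) * a h := by
    intro j
    have := W_shift hp hβ0.le (D := D) (X := fun η => η x = (h : ℤ) + (j + 1)) (Y := fun η => η x = (h : ℤ) - 1)
      (Z := fun η => η x = (h : ℤ) + j) (Z' := fun η => η x = (h : ℤ)) (j + 1) (by positivity) ?_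
    · have := ENNReal.toReal_mono (by finiteness [hfin ((h : ℤ) + j), hfin h]) this
      rwa [ENNReal.toReal_mul, ENNReal.toReal_mul] at this
    · intro η η' k1 k2
      simp only [k1, k2]
      omega
  have hind : ∀ j : ℕ, a (h + j) * a (h - 1) ^ j ≤ a h ^ j * a h := by
    intro j
    induction j with
    | zero => simp
    | succ j ih =>
      have k0 : 0 ≤ a (h - 1) ^ j := pow_nonneg (hA0 _) _
      calc a (h + (j + 1 : ℕ)) * a (h - 1) ^ (j + 1) = (a (h + (j + 1)) * a (h - 1)) * a (h - 1) ^ j := by push_cast; ring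
        _ ≤ (a (h + j) * a h) * a (h - 1) ^ j := mul_le_mul_of_nonneg_right (hsh j) k0
        _ = (a (h + j) * a (h - 1) ^ j) * a h := by ring
        _ ≤ (a h ^ j * a h) * a h := mul_le_mul_of_nonneg_right ih (hA0 _)
        _ = _ := by ring
  have h2h : 0 < a (h + h) := by
    rcases (hA0 (h + h)).lt_or_eq with k | k
    · exact k
    · rw [← k] at h2; linarith
  have h3 := hind h
  have hE : 0 < Real.exp (β * (4 * C * h)) := Real.exp_pos _
  have h4 : a (h - 1) ^ h ≤ (2 * Real.exp (β * (4 * C * h)) * a h) ^ h := by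
    have k1 : a (h + h) * a (h - 1) ^ h ≤ a (h + h) * ((2 * Real.exp (β * (C * (2 * h) ^ 2))) * a h ^ h) := by
      calc _ ≤ a h ^ h * a h := h3
        _ ≤ a h ^ h * ((2 * Real.exp (β * (C * (2 * h) ^ 2))) * a (h + h)) :=
          mul_le_mul_of_nonneg_left ((hmono _).trans h2) (pow_nonneg (hA0 _) _)
        _ = _ := by ring
    have k2 := le_of_mul_le_mul_left k1 h2h
    refine k2.trans ?_
    rw [mul_pow _ (a h)]
    apply mul_le_mul_of_nonneg_right _ (pow_nonneg (hA0 _) _)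
    rw [mul_pow _ (Real.exp _), ← Real.exp_nat_mul]
    rw [show (h : ℝ) * (β * (4 * C * h)) = β * (C * (2 * h) ^ 2) by ring]
    apply mul_le_mul_of_nonneg_right _ (Real.exp_nonneg _)
    exact le_self_pow₀ (by norm_num) (by omega)
  have h5 : a (h - 1) ≤ 2 * Real.exp (β * (4 * C * h)) * a h :=
    le_of_pow_le_pow_left₀ (by omega) (mul_nonneg (by positivity) (hA0 _)) h4
  rw [← ENNReal.ofReal_toReal (hfin ((h : ℤ) - 1)), ← ENNReal.ofReal_toReal (hfin h), ← ENNReal.ofReal_mul (by positivity)]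
  exact ENNReal.ofReal_le_ofReal h5

lemma ctr_count (z : Site) (m : ℕ) :
    ∑' C : Finset Site, (if Ctr z C ∧ (bd C).card ≤ m then (1 : ℝ≥0∞) else 0) ≤ ENNReal.ofReal (Real.exp (b0 * m)) := by
  calc _ ≤ ∑' C : Finset Site, ENNReal.ofReal (Real.exp (b0 * m)) * (if Ctr z C then ENNReal.ofReal (Real.exp (-b0 * (bd C).card)) else 0) := by
        apply ENNReal.tsum_le_tsum
        intro C
        by_cases h : Ctr z C ∧ (bd C).card ≤ m
        · rw [if_pos h, if_pos h.1, ← ENNReal.ofReal_mul (Real.exp_nonneg _), ← Real.exp_add]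
          rw [ENNReal.one_le_ofReal, Real.one_le_exp_iff]
          have : ((bd C).card : ℝ) ≤ m := by exact_mod_cast h.2
          nlinarith [b0_pos]
        · rw [if_neg h]; exact zero_le
    _ ≤ _ := by
        rw [ENNReal.tsum_mul_left]
        exact mul_le_of_le_one_right zero_le (ctr_sum z)

lemma swap_one {p β : ℝ} (hp : 2 < p) (hβ : 0 ≤ β) {D : Finset Site} (z : Site)
    (hW : W p β D (fun _ => True) ≠ ⊤) {C : Finset Site} (hz : z ∈ C) (hC : C ⊆ D) (hC' : C ⊆ D.image (fun x => x + z)) (h : ℤ) :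
    W p β D (fun η => h ≤ η z ∧ ∀ e ∈ bd C, η (out C e) ≤ 0) ≤ 2 ^ (bd C).card * W p β D (fun η => h ≤ η (0, 0)) := by
  have h1 := W_swap hp hβ hC hC' hz h
  have e1 : W p β (D.image (fun x => x + z)) (fun _ => True) = W p β D (fun _ => True) := W_tr p β D z _
  have e2 : W p β (D.image (fun x => x + z)) (fun η => h ≤ η z) = W p β D (fun η => h ≤ η (0, 0)) := by
    rw [W_tr]
    simp only [sub_self]
    rfl
  rw [e2] at h1
  have h2 := W_fkg hp hβ (D.image (fun x => x + z)) (by rwa [e1]) ((bd C).image (out C))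
  rw [e1] at h2
  simp only [Finset.forall_mem_image] at h2
  set w := W p β D (fun _ => True)
  have hw0 : w ≠ 0 := W_zero_pos D trivial
  have h3 : w ≤ 2 ^ (bd C).card * W p β (D.image (fun x => x + z)) (fun η => ∀ e ∈ bd C, 0 ≤ η (out C e)) := by
    refine h2.trans ?_
    gcongr
    · norm_num
    · exact Finset.card_image_le
  have : w * W p β D (fun η => h ≤ η z ∧ ∀ e ∈ bd C, η (out C e) ≤ 0) ≤ w * (2 ^ (bd C).card * W p β D (fun η => h ≤ η (0, 0))) := by
    calc _ ≤ (2 ^ (bd C).card * W p β (D.image (fun x => x + z)) (fun η => ∀ e ∈ bd C, 0 ≤ η (out C e))) * W p β D (fun η => h ≤ η z ∧ ∀ e ∈ bd C, η (out C e) ≤ 0) := by gcongr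
      _ = 2 ^ (bd C).card * (W p β D (fun η => h ≤ η z ∧ ∀ e ∈ bd C, η (out C e) ≤ 0) * W p β (D.image (fun x => x + z)) (fun η => ∀ e ∈ bd C, 0 ≤ η (out C e))) := by ring
      _ ≤ 2 ^ (bd C).card * (w * W p β D (fun η => h ≤ η (0, 0))) := by gcongr
      _ = _ := by ring
  exact (ENNReal.mul_le_mul_iff_right hw0 hW).1 this

lemma transl {p : ℝ} (hp : 2 < p) : ∃ K : ℕ, ∃ C > (0 : ℝ), ∀ β : ℝ, 2 * b0 ≤ β → 2 ≤ β → qq β ≤ 1 / 16 → ∀ D : Finset Site, RC D →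
    W p β D (fun _ => True) ≠ ⊤ → ∀ (z : Site) (h : ℕ), 1 ≤ h → box z (K * h) ⊆ D → box z (K * h) ⊆ D.image (fun x => x + z) →
    W p β D (fun η => η z = h) ≤ ENNReal.ofReal (Real.exp (C * h)) * W p β D (fun η => η (0, 0) = h) := by
  obtain ⟨C, hC, H⟩ := ratio hp
  set K : ℕ := ⌈2 * C⌉₊ + 4 with hK
  have hKC : 2 * C + 4 ≤ (K : ℝ) := by
    rw [hK]; push_cast
    have := Nat.le_ceil (2 * C)
    linarith
  refine ⟨K, K * (1 + b0) + 2, by have := b0_pos; positivity, ?_⟩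
  intro β hβ2 hβ' hq D hD hW z h hh hb hb'
  have hβ : b0 ≤ β := by linarith [b0_pos]
  have hβ0 : 0 < β := by linarith
  have hh' : (1 : ℝ) ≤ h := by exact_mod_cast hh
  set m := K * h with hm
  have hmono : ∀ {a b : ℕ}, a ≤ b → box z a ⊆ box z b := by
    intro a b hab y hy
    rw [mem_box] at hy ⊢
    omega
  have h1 := H β hβ hq D hD hW z h hh ((hmono (by rw [hm]; gcongr; omega)).trans hb)
  set B : (Site → ℤ) → Prop := fun η => ∃ C : Finset Site, (Ctr z C ∧ (bd C).card ≤ m ∧ ∀ e ∈ bd C, η (out C e) ≤ 0) ∧ C ⊆ D ∧ C ⊆ D.image (fun x => x + z) with hB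
  have hbig : W p β D (fun η => η z = h ∧ ¬ B η) ≤ ENNReal.ofReal (1 / 2) * W p β D (fun η => η z = h) := by
    have := peierls_flx (m := m) hp hβ (D := D) (A := fun η => η z = h ∧ ¬ B η) (B := fun η => η z = (h : ℤ) - 1) z ?_
    · refine this.trans ((mul_le_mul_right h1 _).trans ?_)
      rw [← mul_assoc, ← ENNReal.ofReal_mul (Real.exp_nonneg _)]
      gcongr
      rw [mul_left_comm, ← Real.exp_add]
      have k1 : -(β - b0) * (m : ℝ) + β * (C * h) ≤ -2 := by
        have : (m : ℝ) = K * h := by rw [hm]; push_cast; ring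
        rw [this]
        have k2 : β / 2 * (2 * C + 4) * h ≤ (β - b0) * (K * h) := by
          rw [mul_assoc]
          apply mul_le_mul (by linarith) _ (by positivity) (by linarith)
          apply mul_le_mul_of_nonneg_right hKC (by positivity)
        nlinarith
      calc 2 * Real.exp (-(β - b0) * m + β * (C * h)) ≤ 2 * Real.exp (-2) := by gcongr
        _ ≤ 1 / 2 := by
          have : Real.exp (-2) ≤ 1 / 4 := by
            rw [Real.exp_neg, show (2 : ℝ) = 1 + 1 by norm_num, Real.exp_add, one_div]
            apply inv_anti₀ (by norm_num)
            nlinarith [Real.add_one_le_exp (1 : ℝ)]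
          linarith
    · rintro η hs ⟨hA, hnB⟩
      obtain ⟨C, hC, c1, c2⟩ := ctr_level hD hs (k := 1) le_rfl (x := z) (by rw [hA]; exact_mod_cast hh)
      have c3 := flx_level hp c2
      refine ⟨C, hC, c1, c3, le_trans ?_ c3, by simp [low, c1.1, hA]⟩
      by_contra c
      push Not at c
      have c' : (bd C).card ≤ m := by
        have : (bd C).card < m := by exact_mod_cast c
        omega
      apply hnB
      refine ⟨C, ⟨c1, c', fun e he => by have := (c2 e he).2; omega⟩, hC, ?_⟩
      refine Finset.Subset.trans ?_ hb'
      intro y hy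
      have := ctr_box c1 hy
      rw [abs_le, abs_le] at this
      rw [mem_box]
      omega
  have hA : W p β D (fun η => η z = h) ≤ 2 * W p β D (fun η => η z = h ∧ B η) := by
    refine absorb (r := ENNReal.ofReal (1 / 2)) ?_ ?_ (W_fin hW _)
    · conv_lhs => rw [W_split _ B]
      gcongr
    · rw [ENNReal.ofReal_div_of_pos (by norm_num)]; simp
  have hS : W p β D (fun η => η z = h ∧ B η) ≤ ENNReal.ofReal (Real.exp (b0 * m)) * (2 ^ m * W p β D (fun η => (h : ℤ) ≤ η (0, 0))) := by
    refine (W_le_tsum _ (fun (C : Finset Site) η => (Ctr z C ∧ (bd C).card ≤ m ∧ ∀ e ∈ bd C, η (out C e) ≤ 0) ∧ C ⊆ D ∧ C ⊆ D.image (fun x => x + z)) (fun η _ k => k.2)).trans ?_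
    refine le_trans ?_ (mul_le_mul_left (ctr_count z m) _)
    rw [← ENNReal.tsum_mul_right]
    apply ENNReal.tsum_le_tsum
    intro C
    by_cases c : (Ctr z C ∧ (bd C).card ≤ m) ∧ C ⊆ D ∧ C ⊆ D.image (fun x => x + z)
    · rw [if_pos c.1, one_mul]
      have := swap_one hp hβ0.le z hW c.1.1.1 c.2.1 c.2.2 (h : ℤ)
      refine le_trans (W_mono ?_) (this.trans ?_)
      · rintro η _ ⟨⟨k1, _⟩, k2, _⟩
        exact ⟨k1.ge, k2.2.2⟩
      · gcongr
        · norm_num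
        · exact c.1.2
    · refine le_trans (le_of_eq ?_) zero_le
      have : W p β D (fun _ => False) = 0 := by simp [W]
      rw [← this]
      apply W_congr
      intro η _
      simp only [iff_false]
      rintro ⟨_, k1, k2⟩
      exact c ⟨⟨k1.1, k1.2.1⟩, k2⟩
  have hG := W_ge_eq hp hβ (hq.trans (by
    rw [← ENNReal.toReal_le_toReal (by finiteness) (by finiteness)]; norm_num)) hD hW (0, 0) (h : ℤ) (by positivity)
  calc W p β D (fun η => η z = h) ≤ 2 * (ENNReal.ofReal (Real.exp (b0 * m)) * (2 ^ m * (2 * W p β D (fun η => η (0, 0) = (h : ℤ))))) := by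
        refine hA.trans ?_
        gcongr
        refine hS.trans ?_
        gcongr
    _ = ENNReal.ofReal (2 * Real.exp (b0 * m) * 2 ^ m * 2) * W p β D (fun η => η (0, 0) = (h : ℤ)) := by
        rw [ENNReal.ofReal_mul (by positivity), ENNReal.ofReal_mul (by positivity), ENNReal.ofReal_mul (by positivity), ENNReal.ofReal_pow (by positivity)]
        simp only [ENNReal.ofReal_ofNat]
        ring
    _ ≤ _ := by
        gcongr
        have t : (2 : ℝ) ≤ Real.exp 1 := by linarith [Real.add_one_le_exp (1 : ℝ)]
        have t2 : (2 : ℝ) ^ m ≤ Real.exp m := by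
          calc (2 : ℝ) ^ m ≤ (Real.exp 1) ^ m := by gcongr
            _ = _ := by rw [← Real.exp_nat_mul]; simp
        calc 2 * Real.exp (b0 * m) * 2 ^ m * 2 ≤ Real.exp 1 * Real.exp (b0 * m) * Real.exp m * Real.exp 1 := by gcongr
          _ = Real.exp (1 + b0 * m + m + 1) := by rw [← Real.exp_add, ← Real.exp_add, ← Real.exp_add]
          _ ≤ _ := by
            gcongr
            have : (m : ℝ) = K * h := by rw [hm]; push_cast; ring
            rw [this]
            nlinarith
end

section

lemma polya_step (f : ℕ → ℕ → ℝ) (n₁ n₂ : ℕ → ℕ → ℝ) (h0 : ∀ i j, 0 ≤ n₁ i j) (h0' : ∀ i j, 0 ≤ n₂ i j)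
    (h1 : ∀ i j, f i j - f (i + 1) j ≤ n₁ i j) (h2 : ∀ i j, f i j - f i (j + 1) ≤ n₂ i j) (r : ℕ) :
    (∑ q ∈ Finset.HasAntidiagonal.antidiagonal r, f q.1 q.2) / (r + 1) ≤ (∑ q ∈ Finset.HasAntidiagonal.antidiagonal (r + 1), f q.1 q.2) / (r + 2) +
      (1 / ((r : ℝ) + 1)) * ∑ q ∈ Finset.HasAntidiagonal.antidiagonal r, (n₁ q.1 q.2 + n₂ q.1 q.2) := by
  set G := ∑ q ∈ Finset.HasAntidiagonal.antidiagonal r, f q.1 q.2 with hG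
  set G' := ∑ q ∈ Finset.HasAntidiagonal.antidiagonal (r + 1), f q.1 q.2 with hG'
  set N := ∑ q ∈ Finset.HasAntidiagonal.antidiagonal r, (n₁ q.1 q.2 + n₂ q.1 q.2) with hN
  have e1 : ((r : ℝ) + 1) * G' = ∑ q ∈ Finset.HasAntidiagonal.antidiagonal r, (((q.1 : ℝ) + 1) * f (q.1 + 1) q.2 + ((q.2 : ℝ) + 1) * f q.1 (q.2 + 1)) := by
    have a1 := Finset.Nat.sum_antidiagonal_succ (n := r) (f := fun q : ℕ × ℕ => (q.1 : ℝ) * f q.1 q.2)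
    have a2 := Finset.Nat.sum_antidiagonal_succ' (n := r) (f := fun q : ℕ × ℕ => (q.2 : ℝ) * f q.1 q.2)
    simp only [Nat.cast_zero, zero_mul, zero_add, Nat.cast_add, Nat.cast_one] at a1 a2
    rw [Finset.sum_add_distrib, ← a1, ← a2, ← Finset.sum_add_distrib, hG', Finset.mul_sum]
    apply Finset.sum_congr rfl
    intro q hq
    rw [Finset.HasAntidiagonal.mem_antidiagonal] at hq
    have : (q.1 : ℝ) + q.2 = r + 1 := by exact_mod_cast hq
    rw [← this]; ring
  have e2 : ((r : ℝ) + 2) * G ≤ (r + 1) * G' + (r + 2) * N := by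
    rw [e1, hG, hN, Finset.mul_sum, Finset.mul_sum, ← Finset.sum_add_distrib]
    apply Finset.sum_le_sum
    intro q hq
    rw [Finset.HasAntidiagonal.mem_antidiagonal] at hq
    have hq' : (q.1 : ℝ) + q.2 = r := by exact_mod_cast hq
    have b1 : ((q.1 : ℝ) + 1) * (f q.1 q.2 - f (q.1 + 1) q.2) ≤ (q.1 + 1) * n₁ q.1 q.2 := mul_le_mul_of_nonneg_left (h1 _ _) (by positivity)
    have b2 : ((q.2 : ℝ) + 1) * (f q.1 q.2 - f q.1 (q.2 + 1)) ≤ (q.2 + 1) * n₂ q.1 q.2 := mul_le_mul_of_nonneg_left (h2 _ _) (by positivity)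
    have c1 := h0 q.1 q.2
    have c2 := h0' q.1 q.2
    have d1 : 0 ≤ ((q.2 : ℝ) + 1) * n₁ q.1 q.2 := by positivity
    have d2 : 0 ≤ ((q.1 : ℝ) + 1) * n₂ q.1 q.2 := by positivity
    rw [← hq']
    nlinarith
  have e3 : G' / (r + 2) + (1 / ((r : ℝ) + 1)) * N - G / (r + 1) = ((r + 1) * G' + (r + 2) * N - (r + 2) * G) / ((r + 1) * (r + 2)) := by
    field_simp
  have e4 : 0 ≤ ((r + 1) * G' + (r + 2) * N - (r + 2) * G) / (((r : ℝ) + 1) * (r + 2)) := by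
    apply div_nonneg
    · linarith
    · positivity
  linarith

lemma polya (f : ℕ → ℕ → ℝ) (n₁ n₂ : ℕ → ℕ → ℝ) (h0 : ∀ i j, 0 ≤ n₁ i j) (h0' : ∀ i j, 0 ≤ n₂ i j)
    (h1 : ∀ i j, f i j - f (i + 1) j ≤ n₁ i j) (h2 : ∀ i j, f i j - f i (j + 1) ≤ n₂ i j) (R : ℕ) :
    f 0 0 ≤ (∑ q ∈ Finset.HasAntidiagonal.antidiagonal R, f q.1 q.2) / (R + 1) +
      ∑ r ∈ Finset.range R, (1 / ((r : ℝ) + 1)) * ∑ q ∈ Finset.HasAntidiagonal.antidiagonal r, (n₁ q.1 q.2 + n₂ q.1 q.2) := by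
  induction R with
  | zero => simp
  | succ R ih =>
    rw [Finset.sum_range_succ]
    have := polya_step f n₁ n₂ h0 h0' h1 h2 R
    push_cast
    rw [show (R : ℝ) + 1 + 1 = R + 2 by ring]
    linarith

lemma sum_rpow_le {γ : ℝ} (h0 : 0 < γ) (h1 : γ ≤ 1) (R : ℕ) :
    ∑ r ∈ Finset.range R, ((r : ℝ) + 1) ^ (γ - 1) ≤ (R : ℝ) ^ γ / γ := by
  induction R with
  | zero => simp [Real.zero_rpow h0.ne']
  | succ R ih =>
    rw [Finset.sum_range_succ]
    have hR : (0 : ℝ) < R + 1 := by positivity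
    have b := _root_.rpow_one_add_le_one_add_mul_self (s := -1 / ((R : ℝ) + 1)) (by rw [le_div_iff₀ hR]; nlinarith [(Nat.cast_nonneg R : (0:ℝ) ≤ R)]) h0.le h1
    rw [show 1 + -1 / ((R : ℝ) + 1) = R / (R + 1) by field_simp; ring, Real.div_rpow (by positivity) hR.le, div_le_iff₀ (by positivity)] at b
    rw [Real.rpow_sub_one hR.ne']
    push_cast
    have : ((R : ℝ) + 1) ^ γ / (R + 1) ≤ (((R : ℝ) + 1) ^ γ - R ^ γ) / γ := by
      rw [le_div_iff₀ h0]
      calc ((R : ℝ) + 1) ^ γ / (R + 1) * γ = ((R : ℝ) + 1) ^ γ - (1 + γ * (-1 / ((R : ℝ) + 1))) * ((R : ℝ) + 1) ^ γ := by field_simp; ring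
        _ ≤ _ := by linarith
    rw [sub_div] at this
    linarith

lemma thresh {p : ℝ} (hp : 2 < p) {N τ : ℝ} (hN : 0 ≤ N) (hτ : 0 < τ) : N ≤ τ + N ^ p / τ ^ (p - 1) := by
  rcases le_total N τ with h | h
  · have : 0 ≤ N ^ p / τ ^ (p - 1) := by positivity
    linarith
  · have hN' : 0 < N := hτ.trans_le h
    have : N ≤ N ^ p / τ ^ (p - 1) := by
      rw [le_div_iff₀ (by positivity)]
      calc N * τ ^ (p - 1) ≤ N * N ^ (p - 1) := by
            apply mul_le_mul_of_nonneg_left _ hN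
            exact Real.rpow_le_rpow hτ.le h (by linarith)
        _ = N ^ p := by
            rw [Real.rpow_sub_one hN'.ne']; field_simp
    linarith

/-- number of levels whose contour uses the edge -/
def Nlev (h : ℕ) (C : ℕ → Finset Site) (e : Edge) : ℕ := ((Finset.Icc 1 h).filter (fun k => e ∈ bd (C k))).card

lemma in_out (C : Finset Site) (e : Edge) : (inn C e = e.1 ∧ out C e = tip e) ∨ (inn C e = tip e ∧ out C e = e.1) := by
  unfold inn out
  split_ifs <;> simp

lemma Nlev_le {η : Site → ℤ} {h : ℕ} {C : ℕ → Finset Site}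
    (hC : ∀ k ∈ Finset.Icc 1 h, ∀ e ∈ bd (C k), (k : ℤ) ≤ η (inn (C k) e) ∧ η (out (C k) e) < k) (e : Edge) :
    (Nlev h C e : ℤ) ≤ |η e.1 - η (tip e)| := by
  unfold Nlev
  have : ((Finset.Icc 1 h).filter (fun k => e ∈ bd (C k))).card ≤ (Finset.Ioc (min (η e.1) (η (tip e))) (max (η e.1) (η (tip e)))).card := by
    apply Finset.card_le_card_of_injOn (fun k : ℕ => (k : ℤ))
    · intro k hk
      rw [Finset.mem_coe, Finset.mem_filter] at hk
      have := hC k hk.1 e hk.2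
      rw [Finset.mem_coe, Finset.mem_Ioc]
      change min (η e.1) (η (tip e)) < (k : ℤ) ∧ (k : ℤ) ≤ max (η e.1) (η (tip e))
      rcases in_out (C k) e with ⟨a, b⟩ | ⟨a, b⟩ <;> rw [a, b] at this <;> omega
    · intro a _ b _ hab
      simpa using hab
  rw [Int.card_Ioc] at this
  rcases abs_cases (η e.1 - η (tip e)) with k | k <;> omega

lemma sum_flux {p : ℝ} (hp : 2 < p) {η : Site → ℤ} {h : ℕ} {C : ℕ → Finset Site}
    (hC : ∀ k ∈ Finset.Icc 1 h, ∀ e ∈ bd (C k), (k : ℤ) ≤ η (inn (C k) e) ∧ η (out (C k) e) < k) (S : Finset Edge) :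
    ∑ e ∈ S, (Nlev h C e : ℝ) ^ p ≤ ∑ k ∈ Finset.Icc 1 h, Flx p (C k) η := by
  have hpos : ∀ k ∈ Finset.Icc 1 h, ∀ e ∈ bd (C k), 1 ≤ dV p (η (inn (C k) e) - η (out (C k) e)) := by
    intro k hk e he
    apply dV_ge_one hp
    have := hC k hk e he
    omega
  calc ∑ e ∈ S, (Nlev h C e : ℝ) ^ p ≤ ∑ e ∈ S, ∑ k ∈ Finset.Icc 1 h, (if e ∈ bd (C k) then dV p (η (inn (C k) e) - η (out (C k) e)) else 0) := by
        apply Finset.sum_le_sum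
        intro e _
        rw [← Finset.sum_filter]
        set N := Nlev h C e with hN
        have key : ∀ k ∈ (Finset.Icc 1 h).filter (fun k => e ∈ bd (C k)), (N : ℝ) ^ (p - 1) ≤ dV p (η (inn (C k) e) - η (out (C k) e)) := by
          intro k hk
          have hN1 : 1 ≤ N := Finset.card_pos.2 ⟨k, hk⟩
          rw [Finset.mem_filter] at hk
          have a1 := hC k hk.1 e hk.2
          have a2 := Nlev_le hC e
          rw [← hN] at a2
          refine (dV_ge hp N hN1).trans (dV_mono hp ?_)
          rcases in_out (C k) e with ⟨a, b⟩ | ⟨a, b⟩ <;> rw [a, b] at a1 ⊢ <;>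
            rcases abs_cases (η e.1 - η (tip e)) with k | k <;> omega
        have := Finset.sum_le_sum key
        rw [Finset.sum_const, nsmul_eq_mul] at this
        refine le_trans (le_of_eq ?_) this
        change (N : ℝ) ^ p = (N : ℝ) * (N : ℝ) ^ (p - 1)
        rcases Nat.eq_zero_or_pos N with z | z
        · rw [z]; simp [Real.zero_rpow (show p ≠ 0 by linarith)]
        · rw [Real.rpow_sub_one (by positivity)]; field_simp
    _ = ∑ k ∈ Finset.Icc 1 h, ∑ e ∈ S, (if e ∈ bd (C k) then dV p (η (inn (C k) e) - η (out (C k) e)) else 0) := Finset.sum_comm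
    _ ≤ _ := by
        apply Finset.sum_le_sum
        intro k hk
        rw [← Finset.sum_filter]
        unfold Flx
        apply Finset.sum_le_sum_of_subset_of_nonneg
        · intro e he
          exact (Finset.mem_filter.1 he).2
        · intro e he _
          linarith [hpos k hk e he]

lemma lev_grad (h : ℕ) (C : ℕ → Finset Site) (e : Edge) :
    (((Finset.Icc 1 h).filter (fun k => e.1 ∈ C k)).card : ℝ) - (((Finset.Icc 1 h).filter (fun k => tip e ∈ C k)).card : ℝ) ≤ Nlev h C e := by
  rw [sub_le_iff_le_add]
  unfold Nlev
  have : ((Finset.Icc 1 h).filter (fun k => e.1 ∈ C k)).card ≤ ((Finset.Icc 1 h).filter (fun k => e ∈ bd (C k))).card + ((Finset.Icc 1 h).filter (fun k => tip e ∈ C k)).card := by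
    refine le_trans (Finset.card_le_card ?_) (Finset.card_union_le _ _)
    intro k hk
    rw [Finset.mem_filter] at hk
    rw [Finset.mem_union, Finset.mem_filter, Finset.mem_filter, mem_bd]
    tauto
  exact_mod_cast this

def emb (q : (Σ _ : ℕ, ℕ × ℕ) × Bool) : Edge := (((q.1.2.1 : ℤ), (q.1.2.2 : ℤ)), q.2)

lemma level_sum (φ : Edge → ℝ) (R : ℕ) :
    ∑ r ∈ Finset.range R, ∑ q ∈ Finset.HasAntidiagonal.antidiagonal r, (φ (((q.1 : ℤ), (q.2 : ℤ)), true) + φ (((q.1 : ℤ), (q.2 : ℤ)), false)) =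
    ∑ e ∈ ((((Finset.range R).sigma (fun r => Finset.HasAntidiagonal.antidiagonal r)) ×ˢ (Finset.univ : Finset Bool)).image emb), φ e := by
  rw [Finset.sum_image]
  · rw [Finset.sum_product, Finset.sum_sigma']
    apply Finset.sum_congr rfl
    intro q _
    simp [emb]
  · rintro ⟨⟨r, i, j⟩, b⟩ hq ⟨⟨r', i', j'⟩, b'⟩ hq' hh
    simp only [Finset.coe_product, Set.mem_prod, Finset.mem_coe, Finset.mem_sigma, Finset.HasAntidiagonal.mem_antidiagonal, emb, Prod.mk.injEq, Nat.cast_inj] at hq hq' hh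
    obtain ⟨⟨rfl, rfl⟩, rfl⟩ := hh
    have : r = r' := by rw [← hq.1.2, ← hq'.1.2]
    subst this
    rfl

lemma flux_lemma {p : ℝ} (hp : 2 < p) : ∃ c > (0 : ℝ), ∀ (D : Finset Site), RC D → ∀ η : Site → ℤ, Supp D η → ∀ h : ℕ, 1 ≤ h →
    η (0, 0) = h → ∃ C ⊆ D, Ctr (0, 0) C ∧ ((bd C).card : ℝ) ≤ Flx p C η ∧ c * h ≤ Flx p C η := by
  set γ : ℝ := (p - 2) / (p - 1) with hγ
  have hp1 : 0 < p - 1 := by linarith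
  have hγ0 : 0 < γ := div_pos (by linarith) hp1
  have hγ1 : γ ≤ 1 := by rw [hγ, div_le_one hp1]; linarith
  set c := min (1 / 4) ((γ / 8) ^ (1 / γ) / 3) with hc
  have hc0 : 0 < c := by
    rw [hc]; apply lt_min (by norm_num); positivity
  have hcγ : (3 * c) ^ γ ≤ γ / 8 := by
    have : 3 * c ≤ (γ / 8) ^ (1 / γ) := by
      have := min_le_right (1 / 4) ((γ / 8) ^ (1 / γ) / 3)
      linarith
    calc (3 * c) ^ γ ≤ ((γ / 8) ^ (1 / γ)) ^ γ := Real.rpow_le_rpow (by positivity) this hγ0.le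
      _ = γ / 8 := by
        rw [← Real.rpow_mul (by positivity)]
        rw [one_div_mul_cancel hγ0.ne', Real.rpow_one]
  have hc4 : c ≤ 1 / 4 := min_le_left _ _
  refine ⟨c, hc0, ?_⟩
  intro D hD η hs h hh h0
  have hh' : (0 : ℝ) < h := by exact_mod_cast hh
  have hex : ∀ k : ℕ, ∃ C : Finset Site, k ∈ Finset.Icc 1 h → C ⊆ D ∧ Ctr (0, 0) C ∧ ∀ e ∈ bd C, (k : ℤ) ≤ η (inn C e) ∧ η (out C e) < k := by
    intro k
    by_cases hk : k ∈ Finset.Icc 1 h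
    · rw [Finset.mem_Icc] at hk
      obtain ⟨C, a, b⟩ := ctr_level hD hs (k := k) (by omega) (x := (0, 0)) (by rw [h0]; omega)
      exact ⟨C, fun _ => ⟨a, b⟩⟩
    · exact ⟨∅, fun k => absurd k hk⟩
  choose C hC using hex
  by_contra hcon
  push Not at hcon
  have hF : ∀ k ∈ Finset.Icc 1 h, Flx p (C k) η < c * h := by
    intro k hk
    obtain ⟨a, b, d⟩ := hC k hk
    exact hcon (C k) a b (flx_level hp d)
  have hcard : ∀ k ∈ Finset.Icc 1 h, ((bd (C k)).card : ℝ) < c * h := by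
    intro k hk
    exact lt_of_le_of_lt (flx_level hp (hC k hk).2.2) (hF k hk)
  have hch : 1 < c * h := by
    have h1 : 1 ∈ Finset.Icc 1 h := by simp [hh]
    have := bd_pos (hC 1 h1).2.1.1
    have t : (1 : ℝ) ≤ (bd (C 1)).card := by exact_mod_cast this
    linarith [hcard 1 h1]
  set R := ⌈2 * (c * h)⌉₊ with hR
  have hR1 : 2 * (c * h) ≤ R := Nat.le_ceil _
  have hR2 : (R : ℝ) ≤ 3 * c * h := by
    have := Nat.ceil_lt_add_one (show 0 ≤ 2 * (c * h) by positivity)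
    rw [← hR] at this
    linarith
  set g : ℕ → ℕ → ℝ := fun i j => (((Finset.Icc 1 h).filter (fun k => ((i : ℤ), (j : ℤ)) ∈ C k)).card : ℝ) with hg
  have hg0 : g 0 0 = h := by
    rw [hg]
    simp only [Nat.cast_zero]
    rw [Finset.filter_true_of_mem (fun k hk => (hC k hk).2.1.1)]
    simp
  have hgR : ∑ q ∈ Finset.HasAntidiagonal.antidiagonal R, g q.1 q.2 = 0 := by
    apply Finset.sum_eq_zero
    intro q hq
    rw [Finset.HasAntidiagonal.mem_antidiagonal] at hq
    rw [hg]
    simp only [Nat.cast_eq_zero, Finset.card_eq_zero]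
    rw [Finset.filter_eq_empty_iff]
    intro k hk hm
    have b := ctr_box (hC k hk).2.1 hm
    simp only [sub_zero, Nat.abs_cast] at b
    have b1 : q.1 ≤ (bd (C k)).card := by exact_mod_cast b.1
    have b2 : q.2 ≤ (bd (C k)).card := by exact_mod_cast b.2
    have b3 : (R : ℝ) ≤ 2 * (bd (C k)).card := by
      rw [← hq]
      have : q.1 + q.2 ≤ 2 * (bd (C k)).card := by omega
      exact_mod_cast this
    linarith [hcard k hk]
  have hpol := polya g (fun i j => Nlev h C (((i : ℤ), (j : ℤ)), true)) (fun i j => Nlev h C (((i : ℤ), (j : ℤ)), false))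
    (fun _ _ => by positivity) (fun _ _ => by positivity) ?_ ?_ R
  · rw [hg0, hgR, zero_div, zero_add] at hpol
    set α : ℝ := 1 / (p - 1) with hα
    have hαγ : α = 1 - γ := by rw [hα, hγ]; field_simp; ring
    have hsf := sum_flux hp (fun k hk => (hC k hk).2.2) ((((Finset.range R).sigma (fun r => Finset.HasAntidiagonal.antidiagonal r)) ×ˢ (Finset.univ : Finset Bool)).image emb)
    rw [← level_sum (fun e => (Nlev h C e : ℝ) ^ p) R] at hsf
    have hsF : ∑ k ∈ Finset.Icc 1 h, Flx p (C k) η ≤ h * (c * h) := by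
      have := Finset.sum_le_sum (fun k hk => (hF k hk).le)
      rw [Finset.sum_const, nsmul_eq_mul] at this
      simpa using this
    have hlev : ∀ r ∈ Finset.range R, (1 / ((r : ℝ) + 1)) * ∑ q ∈ Finset.HasAntidiagonal.antidiagonal r, ((Nlev h C (((q.1 : ℤ), (q.2 : ℤ)), true) : ℝ) + Nlev h C (((q.1 : ℤ), (q.2 : ℤ)), false))
        ≤ 2 * (h : ℝ) ^ α * ((r : ℝ) + 1) ^ (γ - 1) + (1 / (h : ℝ)) * ∑ q ∈ Finset.HasAntidiagonal.antidiagonal r, ((Nlev h C (((q.1 : ℤ), (q.2 : ℤ)), true) : ℝ) ^ p + (Nlev h C (((q.1 : ℤ), (q.2 : ℤ)), false) : ℝ) ^ p) := by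
      intro r _
      have hr : (0 : ℝ) < r + 1 := by positivity
      set τ : ℝ := (h / (r + 1)) ^ α with hτ
      have hτ0 : 0 < τ := by positivity
      have hτp : τ ^ (p - 1) = h / (r + 1) := by
        rw [hτ, ← Real.rpow_mul (by positivity), hα, one_div_mul_cancel hp1.ne', Real.rpow_one]
      have hτe : τ = (h : ℝ) ^ α * ((r : ℝ) + 1) ^ (γ - 1) := by
        rw [hτ, Real.div_rpow hh'.le hr.le, show γ - 1 = -α by rw [hαγ]; ring, Real.rpow_neg hr.le]
        rfl
      have hs1 : ∑ q ∈ Finset.HasAntidiagonal.antidiagonal r, ((Nlev h C (((q.1 : ℤ), (q.2 : ℤ)), true) : ℝ) + Nlev h C (((q.1 : ℤ), (q.2 : ℤ)), false)) ≤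
          ∑ q ∈ Finset.HasAntidiagonal.antidiagonal r, (2 * τ + ((r + 1) / h) * ((Nlev h C (((q.1 : ℤ), (q.2 : ℤ)), true) : ℝ) ^ p + (Nlev h C (((q.1 : ℤ), (q.2 : ℤ)), false) : ℝ) ^ p)) := by
        apply Finset.sum_le_sum
        intro q _
        have t1 := thresh hp (N := (Nlev h C (((q.1 : ℤ), (q.2 : ℤ)), true) : ℝ)) (by positivity) hτ0
        have t2 := thresh hp (N := (Nlev h C (((q.1 : ℤ), (q.2 : ℤ)), false) : ℝ)) (by positivity) hτ0
        rw [hτp, div_div_eq_mul_div, mul_div_assoc, mul_comm] at t1 t2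
        linarith
      conv_rhs at hs1 => rw [Finset.sum_add_distrib, Finset.sum_const, ← Finset.mul_sum, Finset.Nat.card_antidiagonal, nsmul_eq_mul]
      calc _ ≤ (1 / ((r : ℝ) + 1)) * _ := mul_le_mul_of_nonneg_left hs1 (by positivity)
        _ = 2 * τ + (1 / (h : ℝ)) * ∑ q ∈ Finset.HasAntidiagonal.antidiagonal r, ((Nlev h C (((q.1 : ℤ), (q.2 : ℤ)), true) : ℝ) ^ p + (Nlev h C (((q.1 : ℤ), (q.2 : ℤ)), false) : ℝ) ^ p) := by
          push_cast
          field_simp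
        _ = _ := by rw [hτe]; ring
    have htot := hpol.trans (Finset.sum_le_sum hlev)
    rw [Finset.sum_add_distrib, ← Finset.mul_sum, ← Finset.mul_sum] at htot
    have f1 : (1 / (h : ℝ)) * ∑ r ∈ Finset.range R, ∑ q ∈ Finset.HasAntidiagonal.antidiagonal r, ((Nlev h C (((q.1 : ℤ), (q.2 : ℤ)), true) : ℝ) ^ p + (Nlev h C (((q.1 : ℤ), (q.2 : ℤ)), false) : ℝ) ^ p) ≤ c * h := by
      calc _ ≤ (1 / (h : ℝ)) * (h * (c * h)) := mul_le_mul_of_nonneg_left (hsf.trans hsF) (by positivity)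
        _ = _ := by field_simp
    have f2 : 2 * (h : ℝ) ^ α * ∑ r ∈ Finset.range R, ((r : ℝ) + 1) ^ (γ - 1) ≤ h / 4 := by
      have k1 : (R : ℝ) ^ γ ≤ (γ / 8) * (h : ℝ) ^ γ := by
        calc (R : ℝ) ^ γ ≤ (3 * c * h) ^ γ := Real.rpow_le_rpow (by positivity) hR2 hγ0.le
          _ = (3 * c) ^ γ * (h : ℝ) ^ γ := Real.mul_rpow (by positivity) (by positivity)
          _ ≤ _ := mul_le_mul_of_nonneg_right hcγ (by positivity)
      calc _ ≤ 2 * (h : ℝ) ^ α * ((R : ℝ) ^ γ / γ) := mul_le_mul_of_nonneg_left (sum_rpow_le hγ0 hγ1 R) (by positivity)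
        _ ≤ 2 * (h : ℝ) ^ α * ((γ / 8) * (h : ℝ) ^ γ / γ) := by gcongr
        _ = ((h : ℝ) ^ α * (h : ℝ) ^ γ) / 4 := by field_simp; ring
        _ = h / 4 := by rw [← Real.rpow_add hh', hαγ]; simp
    have := mul_le_mul_of_nonneg_right hc4 hh'.le
    linarith
  · intro i j
    have := lev_grad h C (((i : ℤ), (j : ℤ)), true)
    simp only [tip, if_true] at this
    rw [hg]
    push_cast
    exact this
  · intro i j
    have := lev_grad h C (((i : ℤ), (j : ℤ)), false)
    simp only [tip, Bool.false_eq_true, if_false] at this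
    rw [hg]
    push_cast
    exact this
end

section
open ENNReal NNReal

lemma bd_sing_card (x : Site) : (bd {x}).card ≤ 4 := by
  have : bd {x} ⊆ {(x, true), (x, false), ((x.1 - 1, x.2), true), ((x.1, x.2 - 1), false)} := by
    rintro ⟨⟨a, b⟩, j⟩ he
    obtain ⟨u, v⟩ := x
    rw [mem_bd] at he
    cases j <;> simp [tip] at he ⊢ <;> omega
  refine (Finset.card_le_card this).trans ?_
  exact Finset.card_le_four

def nbs (x : Site) : Finset Site := (bd {x}).image (out {x})

lemma nbs_card (x : Site) : (nbs x).card ≤ 4 := Finset.card_image_le.trans (bd_sing_card x)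

lemma flx_sing (p : ℝ) (x : Site) (η : Site → ℤ) : Flx p {x} η = ∑ e ∈ bd {x}, dV p (η x - η (out {x} e)) := by
  unfold Flx
  apply Finset.sum_congr rfl
  intro e he
  have := inn_mem he
  rw [Finset.mem_singleton] at this
  rw [this]

lemma flx_sing_ge {p : ℝ} (hp : 2 < p) (x : Site) (η : Site → ℤ) (h : ∀ y ∈ nbs x, η y ≤ η x) : -4 ≤ Flx p {x} η := by
  rw [flx_sing]
  have : ∑ e ∈ bd {x}, (-1 : ℝ) ≤ ∑ e ∈ bd {x}, dV p (η x - η (out {x} e)) := by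
    apply Finset.sum_le_sum
    intro e he
    rw [← dV_zero hp]
    apply dV_mono hp
    have := h _ (Finset.mem_image_of_mem _ he)
    omega
  rw [Finset.sum_const, nsmul_eq_mul] at this
  have c : ((bd {x}).card : ℝ) ≤ 4 := by exact_mod_cast bd_sing_card x
  linarith

lemma small_h {p β : ℝ} (hp : 2 < p) (hβ : b0 ≤ β) (hq : qq β ≤ 1 / 16) {D : Finset Site} (hD : RC D)
    (hW : W p β D (fun _ => True) ≠ ⊤) (z : Site) (hz : z ≠ (0, 0)) (h : ℤ) (hh : 1 ≤ h) :
    W p β D (fun η => η z = h ∧ η (0, 0) = h) + ENNReal.ofReal (Real.exp (-(4 * β)) / 2) * W p β D (fun η => η z = h ∧ η (0, 0) = h) ≤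
      W p β D (fun η => η (0, 0) = h) := by
  have hb : 0 < β := b0_pos.trans_le hβ
  have h1 := W_nb hp hβ hq hD hW z (0, 0) h (by omega) (nbs z) (nbs_card z)
  have h2 := W_inj (p := p) (δ := -4) hb.le (D := D) (D' := D) (A := fun η => (η (0, 0) = h ∧ η z = h) ∧ ∀ y ∈ nbs z, η y ≤ h)
    (B := fun η => η (0, 0) = h ∧ ¬ η z = h) (low {z}) (low_inj _) ?_
  · have h3 := W_split (p := p) (β := β) (D := D) (fun η => η (0, 0) = h) (fun η => η z = h)
    have h4 : W p β D (fun η => η z = h ∧ η (0, 0) = h) = W p β D (fun η => η (0, 0) = h ∧ η z = h) := W_congr fun η _ => and_comm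
    rw [h4, h3]
    gcongr
    calc _ ≤ ENNReal.ofReal (Real.exp (-(4 * β)) / 2) * (2 * (ENNReal.ofReal (Real.exp (-β * -4)) * W p β D (fun η => η (0, 0) = h ∧ ¬ η z = h))) := by
          gcongr
          exact h1.trans (by gcongr)
      _ = (ENNReal.ofReal (Real.exp (-(4 * β)) / 2) * ENNReal.ofReal 2 * ENNReal.ofReal (Real.exp (-β * -4))) * W p β D (fun η => η (0, 0) = h ∧ ¬ η z = h) := by
          rw [show ENNReal.ofReal 2 = 2 by simp]; ring
      _ = _ := by
          rw [← ENNReal.ofReal_mul (by positivity), ← ENNReal.ofReal_mul (by positivity)]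
          rw [show Real.exp (-(4 * β)) / 2 * 2 * Real.exp (-β * -4) = 1 by
            rw [div_mul_cancel₀ _ (by norm_num), ← Real.exp_add]; ring_nf; simp]
          simp
  · rintro η hs ⟨⟨a, b⟩, d⟩
    have hzD : z ∈ D := by
      by_contra k
      have := hs z k
      omega
    have hsub : ({z} : Finset Site) ⊆ D := by simpa using hzD
    refine ⟨supp_low hsub hs, ⟨?_, ?_⟩, ?_⟩
    · simp [low, Ne.symm hz, a]
    · simp [low, b]
    · have := pH_low hp hsub hs
      have k := flx_sing_ge hp z η (by rw [b]; exact d)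
      linarith

lemma low_low {C : Finset Site} {x : Site} (hx : x ∈ C) (η : Site → ℤ) : low {x} (low (C.erase x) η) = low C η := by
  funext y
  unfold low
  by_cases k : y = x
  · subst k; simp [hx]
  · simp [k]

lemma large_h {p : ℝ} (hp : 2 < p) : ∃ δ > (0 : ℝ), ∃ h₀ : ℕ, ∀ β : ℝ, 2 * b0 ≤ β → qq β ≤ 1 / 16 → ∀ D : Finset Site, RC D →
    W p β D (fun _ => True) ≠ ⊤ → ∀ z : Site, z ≠ (0, 0) → ∀ h : ℕ, 1 ≤ h → h₀ ≤ h →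
    W p β D (fun η => η z = h ∧ η (0, 0) = h) ≤ 2 * (ENNReal.ofReal (Real.exp (-β * (δ * h))) * W p β D (fun η => η z = h) +
      ENNReal.ofReal (Real.exp (-β * (δ * h))) * W p β D (fun η => η (0, 0) = h)) := by
  obtain ⟨c, hc, H⟩ := flux_lemma hp
  have hCp : 1 ≤ Cp p := by
    unfold Cp
    have : (1 : ℝ) ≤ 2 ^ (p - 1) := Real.one_le_rpow (by norm_num) (by linarith)
    nlinarith
  set δ := c / (8 * Cp p) with hδ
  have hδ0 : 0 < δ := by positivity
  have hδC : Cp p * δ = c / 8 := by rw [hδ]; field_simp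
  have hδc : δ ≤ c / 8 := by nlinarith
  refine ⟨δ, hδ0, ⌈32 * Cp p / c⌉₊, ?_⟩
  intro β hβ hq D hD hW z hz h hh hh0
  have hb0 := b0_pos
  have hb : 0 < β := by linarith
  have hb2 : b0 ≤ β := by linarith
  have hh' : (1 : ℝ) ≤ h := by exact_mod_cast hh
  have hhC : 32 * Cp p ≤ c * h := by
    have : 32 * Cp p / c ≤ h := Nat.ceil_le.1 hh0
    rw [div_le_iff₀ hc] at this
    linarith
  refine (W_nb hp hb2 hq hD hW (0, 0) z h (by omega) (nbs (0, 0)) (nbs_card _)).trans ?_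
  gcongr
  refine (W_le_add _ (fun η => (η z = h ∧ η (0, 0) = h) ∧ δ * h ≤ Flx p {(0, 0)} η)
    (fun η => ((η z = h ∧ η (0, 0) = h) ∧ ∀ y ∈ nbs (0, 0), η y ≤ h) ∧ Flx p {(0, 0)} η < δ * h) ?_).trans ?_
  · intro η _ k
    rcases le_or_gt (δ * h) (Flx p {(0, 0)} η) with l | l
    · exact Or.inl ⟨k.1, l⟩
    · exact Or.inr ⟨k, l⟩
  apply add_le_add
  · apply W_inj hb.le (low {(0, 0)}) (low_inj _)
    rintro η hs ⟨⟨a, b⟩, d⟩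
    have hzD : ((0, 0) : Site) ∈ D := by
      by_contra k
      have := hs _ k
      omega
    have hsub : ({(0, 0)} : Finset Site) ⊆ D := by simpa using hzD
    refine ⟨supp_low hsub hs, ?_, ?_⟩
    · simp [low, hz, a]
    · have := pH_low hp hsub hs
      linarith
  · apply peierls hb (0, 0) (fun C => low (C.erase (0, 0))) (fun C => low_inj _)
    rintro η hs ⟨⟨⟨a, b⟩, d⟩, f⟩
    have hzD : ((0, 0) : Site) ∈ D := by
      by_contra k
      have := hs _ k
      omega
    have hsub : ({(0, 0)} : Finset Site) ⊆ D := by simpa using hzD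
    obtain ⟨C, hCD, hC, h1, h2⟩ := H D hD η hs h hh b
    have hs' : Supp D (low (C.erase (0, 0)) η) := supp_low ((Finset.erase_subset _ _).trans hCD) hs
    refine ⟨C, hC, hs', ?_, ?_⟩
    · simp [low, b]
    · have e1 := pH_low hp hCD hs
      have e2 := pH_low hp hsub hs'
      rw [low_low hC.1] at e2
      have e3 : Flx p {(0, 0)} (low (C.erase (0, 0)) η) ≤ Cp p * (δ * h + 8) := by
        calc Flx p {(0, 0)} (low (C.erase (0, 0)) η) ≤ ∑ e ∈ bd {(0, 0)}, Cp p * (dV p (η (0, 0) - η (out {(0, 0)} e)) + 2) := by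
              rw [flx_sing]
              apply Finset.sum_le_sum
              intro e he
              have := d _ (Finset.mem_image_of_mem _ he)
              refine le_trans (dV_mono hp ?_) (dV_succ_le hp _ ?_)
              · unfold low
                split_ifs <;> simp_all <;> omega
              · omega
          _ = Cp p * (Flx p {(0, 0)} η + 2 * (bd {(0, 0)}).card) := by
              rw [← Finset.mul_sum, Finset.sum_add_distrib, ← flx_sing, Finset.sum_const, nsmul_eq_mul]; ring
          _ ≤ _ := by
              have cc : ((bd {((0, 0) : Site)}).card : ℝ) ≤ 4 := by exact_mod_cast bd_sing_card (0, 0)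
              apply mul_le_mul_of_nonneg_left _ (by linarith)
              linarith
      have e4 : b0 / β * (bd C).card ≤ Flx p C η / 2 := by
        have : b0 / β ≤ 1 / 2 := by rw [div_le_iff₀ hb]; linarith
        have n : (0 : ℝ) ≤ (bd C).card := by positivity
        nlinarith
      have e5 : Cp p * (δ * h + 8) = c * h / 8 + 8 * Cp p := by
        rw [mul_add, ← mul_assoc, hδC]; ring
      have e6 : δ * h ≤ c / 8 * h := mul_le_mul_of_nonneg_right hδc (by linarith)
      linarith

lemma main_W {p : ℝ} (hp : 2 < p) : ∃ β₀ > (0 : ℝ), ∃ K : ℕ, ∀ β ≥ β₀, ∃ c > (0 : ℝ), ∀ D : Finset Site, RC D →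
    W p β D (fun _ => True) ≠ ⊤ → ∀ z : Site, z ≠ (0, 0) → ∀ h : ℕ, 1 ≤ h → box z (K * h) ⊆ D → box z (K * h) ⊆ D.image (fun x => x + z) →
    W p β D (fun η => η z = h ∧ η (0, 0) = h) ≤ ENNReal.ofReal (Real.exp (-c * β * h)) * W p β D (fun η => η (0, 0) = h) := by
  obtain ⟨δ, hδ, h₀, HL⟩ := large_h hp
  obtain ⟨K, C, hC, HT⟩ := transl hp
  have hb0 := b0_pos
  refine ⟨2 * b0 + 2 + Real.log 16 + 2 * (C + 2) / δ, ?_, K, ?_⟩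
  · have := Real.log_nonneg (show (1 : ℝ) ≤ 16 by norm_num)
    positivity
  intro β hβ
  have l16 := Real.log_nonneg (show (1 : ℝ) ≤ 16 by norm_num)
  have hCd : 0 ≤ 2 * (C + 2) / δ := by positivity
  have g1 : 2 * b0 ≤ β := by linarith
  have g2 : 2 ≤ β := by linarith
  have g3 : qq β ≤ 1 / 16 := by
    unfold qq
    rw [show (1 / 16 : ℝ≥0∞) = ENNReal.ofReal (1 / 16) by
      rw [ENNReal.ofReal_div_of_pos (by norm_num)]; simp]
    apply ENNReal.ofReal_le_ofReal
    rw [show (1 / 16 : ℝ) = Real.exp (-Real.log 16) by rw [Real.exp_neg, Real.exp_log (by norm_num)]; norm_num]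
    apply Real.exp_le_exp.2
    linarith
  have g4 : C + 2 ≤ β * δ / 2 := by
    have : 2 * (C + 2) / δ ≤ β := by linarith
    rw [div_le_iff₀ hδ] at this
    linarith
  have hb : 0 < β := by linarith
  set a := Real.exp (-(4 * β)) / 2 with ha
  have ha0 : 0 < a := by positivity
  have hla : 0 < Real.log (1 + a) := Real.log_pos (by linarith)
  set c2 := Real.log (1 + a) / (β * (h₀ + 1)) with hc2
  refine ⟨min (δ / 2) c2, lt_min (by positivity) (by positivity), ?_⟩
  intro D hD hW z hz h hh hx1 hx2
  have hh' : (1 : ℝ) ≤ h := by exact_mod_cast hh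
  rcases le_or_gt h₀ h with k | k
  · have HL1 := HL β g1 g3 D hD hW z hz h hh k
    have HT1 := HT β g1 g2 g3 D hD hW z h hh hx1 hx2
    set W0 := W p β D (fun η => η (0, 0) = h)
    refine HL1.trans ?_
    calc _ ≤ 2 * (ENNReal.ofReal (Real.exp (-β * (δ * h))) * (ENNReal.ofReal (Real.exp (C * h)) * W0) +
            ENNReal.ofReal (Real.exp (-β * (δ * h))) * (ENNReal.ofReal (Real.exp (C * h)) * W0)) := by
          gcongr
          nth_rewrite 1 [← one_mul W0]
          gcongr
          rw [← ENNReal.ofReal_one]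
          apply ENNReal.ofReal_le_ofReal
          apply Real.one_le_exp
          positivity
      _ = (ENNReal.ofReal 4 * (ENNReal.ofReal (Real.exp (-β * (δ * h))) * ENNReal.ofReal (Real.exp (C * h)))) * W0 := by
          rw [show ENNReal.ofReal 4 = 4 by simp]; ring
      _ ≤ _ := by
          gcongr
          rw [← ENNReal.ofReal_mul (by positivity), ← ENNReal.ofReal_mul (by positivity), ← Real.exp_add]
          apply ENNReal.ofReal_le_ofReal
          have e4 : (4 : ℝ) ≤ Real.exp 2 := by
            have := Real.add_one_le_exp (1 : ℝ)
            rw [show (2 : ℝ) = 1 + 1 by norm_num, Real.exp_add]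
            nlinarith
          calc 4 * Real.exp (-β * (δ * h) + C * h) ≤ Real.exp 2 * Real.exp (-β * (δ * h) + C * h) := by gcongr
            _ = Real.exp (2 + (-β * (δ * h) + C * h)) := by rw [← Real.exp_add]
            _ ≤ _ := by
              apply Real.exp_le_exp.2
              have m1 : min (δ / 2) c2 * (β * h) ≤ δ / 2 * (β * h) := mul_le_mul_of_nonneg_right (min_le_left _ _) (by positivity)
              have m2 : (C + 2) * h ≤ β * δ / 2 * h := mul_le_mul_of_nonneg_right g4 (by linarith)
              linarith
  · have HS := small_h hp (by linarith) g3 hD hW z hz h (by omega)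
    rw [← ha] at HS
    set X := W p β D (fun η => η z = h ∧ η (0, 0) = h)
    have e1 : ENNReal.ofReal (1 + a) * X ≤ W p β D (fun η => η (0, 0) = h) := by
      refine le_trans (le_of_eq ?_) HS
      rw [ENNReal.ofReal_add (by norm_num) ha0.le, add_mul]; simp
    refine le_trans ?_ (mul_le_mul_right e1 _)
    rw [← mul_assoc, ← ENNReal.ofReal_mul (by positivity)]
    nth_rewrite 1 [← one_mul X]
    gcongr
    rw [← ENNReal.ofReal_one]
    apply ENNReal.ofReal_le_ofReal
    rw [← Real.exp_log (show 0 < 1 + a by linarith), ← Real.exp_add]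
    apply Real.one_le_exp
    have m1 : min (δ / 2) c2 * (β * h) ≤ c2 * (β * h) := mul_le_mul_of_nonneg_right (min_le_right _ _) (by positivity)
    have m2 : c2 * (β * h) ≤ c2 * (β * (h₀ + 1)) := by
      have : (h : ℝ) ≤ h₀ + 1 := by
        have : h ≤ h₀ + 1 := by omega
        exact_mod_cast this
      gcongr
    have m3 : c2 * (β * (h₀ + 1)) = Real.log (1 + a) := by rw [hc2]; field_simp
    linarith
end

section
open ENNReal NNReal

lemma mem_ball_iff (L : ℕ) (x : Site) : x ∈ ball (L : ℝ) ↔ x.1 ^ 2 + x.2 ^ 2 ≤ (L : ℤ) ^ 2 := by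
  unfold ball
  rw [Finset.mem_filter, Finset.mem_product, Finset.mem_Icc, Finset.mem_Icc]
  rw [show ⌈((L : ℕ) : ℝ)⌉ = (L : ℤ) by simp]
  constructor
  · rintro ⟨_, h⟩
    exact_mod_cast h
  · intro h
    have h1 : |x.1| ≤ (L : ℤ) := abs_le_of_sq_le_sq (by nlinarith [sq_nonneg x.2]) (by positivity)
    have h2 : |x.2| ≤ (L : ℤ) := abs_le_of_sq_le_sq (by nlinarith [sq_nonneg x.1]) (by positivity)
    rw [abs_le] at h1 h2
    refine ⟨⟨h1, h2⟩, ?_⟩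
    exact_mod_cast h

lemma ball_RC (L : ℕ) : RC (ball (L : ℝ)) := by
  intro a b c j h1 h2 h3 h4
  rw [mem_ball_iff] at *
  simp only at *
  rcases le_total 0 b with k | k <;> nlinarith

lemma mem_ball_of {L : ℕ} {x : Site} {M : ℤ} (h1 : |x.1| ≤ M) (h2 : |x.2| ≤ M) (h : 2 * M ≤ L) : x ∈ ball (L : ℝ) := by
  rw [mem_ball_iff]
  have hM : 0 ≤ M := (abs_nonneg _).trans h1
  have e1 := sq_le_sq.2 (h1.trans (le_abs_self M))
  have e2 := sq_le_sq.2 (h2.trans (le_abs_self M))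
  nlinarith

lemma pW_toReal {p β : ℝ} {D : Finset Site} {A : (Site → ℤ) → Prop} : pW p β D A = (W p β D A).toReal := by
  unfold pW W
  rw [ENNReal.tsum_toReal_eq]
  · apply tsum_congr
    intro η
    unfold Supp wt
    split_ifs
    · rw [ENNReal.toReal_ofReal (Real.exp_nonneg _)]
    · simp
  · intro η
    unfold wt
    split_ifs <;> simp

end

/-- **Lemma 4.7.** Two-point large deviation for `p > 2`:
`π^{(p)}(η_z = h, η_0 = h) ≤ e^{−cβh} π^{(p)}(η_0 = h)`. -/
theorem pSOS_two_point (p : ℝ) (hp : 2 < p) :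
    ∃ β₀ > (0 : ℝ), ∀ β ≥ β₀, ∃ c > (0 : ℝ),
      ∀ h : ℕ, 1 ≤ h → ∀ z : Site, z ≠ (0, 0) → ∃ L₀ : ℕ, ∀ L : ℕ, L₀ ≤ L →
        pProb p β (ball L) (fun η => η z = (h : ℤ) ∧ η (0, 0) = (h : ℤ)) ≤
          Real.exp (-c * β * (h : ℝ)) *
            pProb p β (ball L) (fun η => η (0, 0) = (h : ℤ)) := by
  obtain ⟨β₀, hβ₀, K, H⟩ := main_W hp
  refine ⟨β₀, hβ₀, fun β hβ => ?_⟩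
  obtain ⟨c, hc, H⟩ := H β hβ
  refine ⟨c, hc, fun h hh z hz => ⟨2 * (z.1.natAbs + z.2.natAbs + K * h), fun L hL => ?_⟩⟩
  unfold pProb
  simp only [pW_toReal]
  by_cases hW : W p β (ball L) (fun _ => True) = ⊤
  · rw [hW]; simp
  have hL' : 2 * (((z.1.natAbs + z.2.natAbs + K * h : ℕ) : ℤ)) ≤ (L : ℤ) := by exact_mod_cast hL
  have := H (ball L) (ball_RC L) hW z hz h hh ?_ ?_
  · rw [← mul_div_assoc]
    apply div_le_div_of_nonneg_right _ ENNReal.toReal_nonneg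
    have t := ENNReal.toReal_mono (ENNReal.mul_ne_top ENNReal.ofReal_ne_top (W_fin hW _)) this
    rwa [ENNReal.toReal_mul, ENNReal.toReal_ofReal (Real.exp_nonneg _)] at t
  · intro y hy
    rw [mem_box] at hy
    refine mem_ball_of ?_ ?_ hL' <;> rw [abs_le] <;> push_cast at * <;> rcases abs_cases z.1 with k | k <;> rcases abs_cases z.2 with k' | k' <;> constructor <;> linarith
  · intro y hy
    rw [mem_box] at hy
    rw [Finset.mem_image]
    refine ⟨y - z, mem_ball_of ?_ ?_ hL', by simp⟩ <;> rw [abs_le] <;> simp only [Prod.fst_sub, Prod.snd_sub] <;> push_cast at * <;> rcases abs_cases z.1 with k | k <;> rcases abs_cases z.2 with k' | k' <;> constructor <;> linarith
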